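/- arXiv:2506.03480 — 2 statements merged into one kernel-verified Lean document; each statement's English description precedes it below -/
import Mathlib

section
/- Let $G$ be the graph obtained from the cycle $C_4$ on vertices $x_1,x_2,x_3,x_4$ by attaching one pendant edge to each of its four vertices: $V(G) = \{x_1,\ldots,x_8\}$ with additional edges $\{x_1,x_5\},\{x_2,x_6\},\{x_3,x_7\},\{x_4,x_8\}$. Then for every $\mathfrak{c} \in \mathbb{Z}_{>0}^8$, the set $\mathcal{W}(\mathfrak{c},G)$ is of Veronese type; in particular, $G$ enjoys the strong exchange property. -/
open Finset

/-- A monomial with exponent vector `a` belongs to the `q`-th power of the edge ideal of `G`: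
it is divisible by a product of `q` edges of `G`. -/
def memPow {n : ℕ} (G : SimpleGraph (Fin n)) (q : ℕ) (a : Fin n → ℕ) : Prop :=
  ∃ e : Fin q → Fin n × Fin n, (∀ i, G.Adj (e i).1 (e i).2) ∧
    ∀ j, (∑ i, ((if (e i).1 = j then 1 else 0) + (if (e i).2 = j then 1 else 0))) ≤ a j

/-- The exponent vector `a` is componentwise bounded by `c`. -/
def bdd {n : ℕ} (c a : Fin n → ℕ) : Prop := ∀ i, a i ≤ c i

/-- `δ_c(I(G))`: the largest `q` such that `(I(G)^q)_c ≠ 0`, i.e. such that some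
`c`-bounded monomial lies in `I(G)^q`. -/
noncomputable def deltaC {n : ℕ} (G : SimpleGraph (Fin n)) (c : Fin n → ℕ) : ℕ :=
  sSup {q | ∃ a, bdd c a ∧ memPow G q a}

/-- `W(c,G)`: the minimal monomial generators of `(I(G)^{δ_c(I(G))})_c`, i.e. the
`c`-bounded monomials of `I(G)^{δ_c}` that are minimal with respect to divisibility. -/
def genW {n : ℕ} (G : SimpleGraph (Fin n)) (c : Fin n → ℕ) : Set (Fin n → ℕ) :=
  {a | bdd c a ∧ memPow G (deltaC G c) a ∧
    ∀ b, bdd a b → memPow G (deltaC G c) b → b = a}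

/-- The monomial `x_ρ · u / x_ξ`. -/
def exch {n : ℕ} (u : Fin n → ℕ) (ξ ρ : Fin n) : Fin n → ℕ :=
  fun i => if i = ρ then u i + 1 else if i = ξ then u i - 1 else u i

/-- `W(c,G)` enjoys the strong exchange property. -/
def SEPc {n : ℕ} (G : SimpleGraph (Fin n)) (c : Fin n → ℕ) : Prop :=
  ∀ u ∈ genW G c, ∀ v ∈ genW G c, ∀ ξ ρ : Fin n, v ξ < u ξ → u ρ < v ρ →
    exch u ξ ρ ∈ genW G c

/-- The graph `G` enjoys the strong exchange property: `W(c,G)` does, for every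
`c ∈ ℤ_{>0}^n`. -/
def SEP {n : ℕ} (G : SimpleGraph (Fin n)) : Prop :=
  ∀ c : Fin n → ℕ, (∀ i, 0 < c i) → SEPc G c

/-- The cycle graph on `Fin m`. -/
def cycleG (m : ℕ) : SimpleGraph (Fin m) :=
  SimpleGraph.fromRel (fun i j => (i.val + 1) % m = j.val)

/-- The path graph on `Fin m`. -/
def pathG (m : ℕ) : SimpleGraph (Fin m) :=
  SimpleGraph.fromRel (fun i j => i.val + 1 = j.val)

/-- A set of monomials is of Veronese type: it equals `w · V^{(d)}(a)`, the set of
translates by a fixed monomial `w` of all monomials of degree `d` componentwise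
bounded by `a`. -/
def IsVeronese {n : ℕ} (S : Set (Fin n → ℕ)) : Prop :=
  ∃ (w : Fin n → ℕ) (d : ℕ) (a : Fin n → ℕ), d ≤ ∑ i, a i ∧
    S = {u | ∃ v : Fin n → ℕ, (∀ i, v i ≤ a i) ∧ (∑ i, v i) = d ∧
      u = fun i => w i + v i}

/-- The graph on `Fin m` with edges given by a list of (0-based) pairs. -/
def listGraph (m : ℕ) (E : List (ℕ × ℕ)) : SimpleGraph (Fin m) :=
  SimpleGraph.fromRel (fun i j => (i.val, j.val) ∈ E)

/-- The cycle `C₄` on `0,1,2,3` with a pendant edge attached to each vertex. -/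
def G16 : SimpleGraph (Fin 8) :=
  listGraph 8 [(0,1),(1,2),(2,3),(0,3),(0,4),(1,5),(2,6),(3,7)]

lemma memPow_zero {n : ℕ} (G : SimpleGraph (Fin n)) (a : Fin n → ℕ) : memPow G 0 a :=
  ⟨Fin.elim0, fun i => i.elim0, fun j => by simp⟩

lemma memPow_succ {n : ℕ} (G : SimpleGraph (Fin n)) (q : ℕ) (a : Fin n → ℕ) :
    memPow G (q + 1) a ↔ ∃ x y b, G.Adj x y ∧ memPow G q b ∧
      ∀ j, ((if x = j then 1 else 0) + (if y = j then 1 else 0)) + b j ≤ a j := by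
  constructor
  · rintro ⟨e, he, h⟩
    refine ⟨(e 0).1, (e 0).2, _, he 0,
      ⟨fun i => e i.succ, fun i => he i.succ, fun j => le_rfl⟩, fun j => ?_⟩
    have := h j
    rwa [Fin.sum_univ_succ] at this
  · rintro ⟨x, y, b, hxy, ⟨e, he, h⟩, hb⟩
    refine ⟨Fin.cons (x, y) e, fun i => ?_, fun j => ?_⟩
    · refine Fin.cases ?_ (fun i => ?_) i
      · simpa using hxy
      · simpa using he i
    · rw [Fin.sum_univ_succ]
      simp only [Fin.cons_zero, Fin.cons_succ]
      have := h j
      have := hb j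
      lia

/-- Powers of an edge ideal are invariant under graph automorphisms. -/
lemma memPow_comp {n : ℕ} {G : SimpleGraph (Fin n)} (σ : G ≃g G) {q : ℕ} {a : Fin n → ℕ} :
    memPow G q (a ∘ σ) ↔ memPow G q a := by
  have key : ∀ (τ : G ≃g G) (b : Fin n → ℕ), memPow G q b → memPow G q (b ∘ τ) := by
    rintro τ b ⟨e, he, h⟩
    refine ⟨fun i => (τ.symm (e i).1, τ.symm (e i).2),
      fun i => τ.symm.map_adj_iff.2 (he i), fun j => ?_⟩
    have hx : ∀ x : Fin n, τ.symm x = j ↔ x = τ j := fun x => τ.toEquiv.symm_apply_eq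
    simpa only [hx, Function.comp_apply] using h (τ j)
  refine ⟨fun h => ?_, key σ a⟩
  convert key σ.symm _ h using 1
  ext j
  simp

lemma bdd_comp {n : ℕ} (σ : Fin n ≃ Fin n) {c a : Fin n → ℕ} :
    bdd (c ∘ σ) (a ∘ σ) ↔ bdd c a :=
  σ.forall_congr_left.trans (by simp [bdd])

lemma deltaC_comp {n : ℕ} {G : SimpleGraph (Fin n)} (σ : G ≃g G) (c : Fin n → ℕ) :
    deltaC G (c ∘ σ) = deltaC G c := by
  unfold deltaC
  congr 1
  ext q
  constructor
  · rintro ⟨a, ha, h⟩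
    have e : a = (a ∘ σ.symm) ∘ σ := by ext j; simp
    rw [e] at ha h
    exact ⟨a ∘ σ.symm, (bdd_comp σ.toEquiv).1 ha, (memPow_comp σ).1 h⟩
  · rintro ⟨a, ha, h⟩
    exact ⟨a ∘ σ, (bdd_comp σ.toEquiv).2 ha, (memPow_comp σ).2 h⟩

lemma comp_mem_genW {n : ℕ} {G : SimpleGraph (Fin n)} (σ : G ≃g G) {c a : Fin n → ℕ} :
    a ∘ σ ∈ genW G (c ∘ σ) ↔ a ∈ genW G c := by
  simp only [genW, Set.mem_ofPred_eq, deltaC_comp, memPow_comp]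
  refine and_congr (bdd_comp σ.toEquiv)
    (and_congr Iff.rfl ⟨fun h b hb hm => ?_, fun h b hb hm => ?_⟩)
  · have := h (b ∘ σ) ((bdd_comp σ.toEquiv).2 hb) ((memPow_comp σ).2 hm)
    exact σ.surjective.injective_comp_right this
  · have e : b = (b ∘ σ.symm) ∘ σ := by ext j; simp
    rw [e] at hb hm ⊢
    rw [h _ ((bdd_comp σ.toEquiv).1 hb) ((memPow_comp σ).1 hm)]

lemma IsVeronese.comp {n : ℕ} {S : Set (Fin n → ℕ)} (hS : IsVeronese S) (σ : Fin n ≃ Fin n) :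
    IsVeronese {u | u ∘ σ ∈ S} := by
  obtain ⟨w, d, a, hd, rfl⟩ := hS
  refine ⟨w ∘ σ.symm, d, a ∘ σ.symm, ?_, ?_⟩
  · rwa [← Equiv.sum_comp σ.symm a] at hd
  · ext u
    constructor
    · rintro ⟨v, hv, hs, hu⟩
      refine ⟨v ∘ σ.symm, fun i => hv _, ?_, ?_⟩
      · rw [← hs]; exact Equiv.sum_comp σ.symm v
      · ext i; simpa using congrFun hu (σ.symm i)
    · rintro ⟨v, hv, hs, rfl⟩
      refine ⟨v ∘ σ, fun i => by simpa using hv (σ i), ?_, ?_⟩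
      · rw [← hs]; exact Equiv.sum_comp σ v
      · ext i; simp

/-- Sets of Veronese type enjoy the strong exchange property. -/
lemma IsVeronese.exch_mem {n : ℕ} {S : Set (Fin n → ℕ)} (hS : IsVeronese S) {u v : Fin n → ℕ}
    (hu : u ∈ S) (hv : v ∈ S) {ξ ρ : Fin n} (hξ : v ξ < u ξ) (hρ : u ρ < v ρ) :
    exch u ξ ρ ∈ S := by
  obtain ⟨w, d, a, hd, rfl⟩ := hS
  obtain ⟨x, hx, hxs, rfl⟩ := hu
  obtain ⟨y, hy, hys, rfl⟩ := hv
  have hne : ξ ≠ ρ := by rintro rfl; lia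
  refine ⟨exch x ξ ρ, fun i => ?_, ?_, ?_⟩
  · have := hx i
    have := hy i
    unfold exch
    split_ifs with h1 h2
    · subst h1; lia
    · lia
    · lia
  · have h : ∀ i, exch x ξ ρ i + (if i = ξ then 1 else 0) = x i + (if i = ρ then 1 else 0) := by
      intro i
      unfold exch
      split_ifs with h1 h2 h2
      · exact absurd (h2.symm.trans h1) hne
      · lia
      · subst h2; lia
      · lia
    have hsum := Finset.sum_congr (rfl : (Finset.univ : Finset (Fin n)) = Finset.univ)
      (fun i _ => h i)
    simp only [Finset.sum_add_distrib, Finset.sum_ite_eq', Finset.mem_univ, if_true] at hsum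
    lia
  · ext i
    unfold exch
    split_ifs with h1 h2
    · lia
    · subst h2; lia
    · rfl

/-- Degree vectors in `G16`, in terms of the edge multiplicities `m` on the cycle and `l` on the
pendant edges. -/
lemma memPow_G16 (q : ℕ) (a : Fin 8 → ℕ) :
    memPow G16 q a ↔ ∃ m₀₁ m₁₂ m₂₃ m₀₃ l₀ l₁ l₂ l₃ : ℕ,
      m₀₁ + m₁₂ + m₂₃ + m₀₃ + l₀ + l₁ + l₂ + l₃ = q ∧
      m₀₁ + m₀₃ + l₀ ≤ a 0 ∧ m₀₁ + m₁₂ + l₁ ≤ a 1 ∧ m₁₂ + m₂₃ + l₂ ≤ a 2 ∧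
      m₂₃ + m₀₃ + l₃ ≤ a 3 ∧ l₀ ≤ a 4 ∧ l₁ ≤ a 5 ∧ l₂ ≤ a 6 ∧ l₃ ≤ a 7 := by
  induction q generalizing a with
  | zero =>
    refine ⟨fun _ => ⟨0, 0, 0, 0, 0, 0, 0, 0, ?_⟩, fun _ => memPow_zero _ _⟩
    simp
  | succ q ih =>
    rw [memPow_succ]
    constructor
    · rintro ⟨x, y, b, hxy, hb, h⟩
      obtain ⟨m₀₁, m₁₂, m₂₃, m₀₃, l₀, l₁, l₂, l₃, hs, h0, h1, h2, h3, h4, h5, h6, h7⟩ := (ih b).1 hb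
      have g0 := h 0
      have g1 := h 1
      have g2 := h 2
      have g3 := h 3
      have g4 := h 4
      have g5 := h 5
      have g6 := h 6
      have g7 := h 7
      clear h hb ih
      have hE : (x.val, y.val) ∈ [(0,1),(1,2),(2,3),(0,3),(0,4),(1,5),(2,6),(3,7)] ∨
          (y.val, x.val) ∈ [(0,1),(1,2),(2,3),(0,3),(0,4),(1,5),(2,6),(3,7)] := hxy.2
      simp only [List.mem_cons, Prod.mk.injEq, List.not_mem_nil, or_false] at hE
      simp only [Fin.ext_iff] at g0 g1 g2 g3 g4 g5 g6 g7
      rcases hE with (h | h | h | h | h | h | h | h) | (h | h | h | h | h | h | h | h) <;>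
        simp only [h.1, h.2] at g0 g1 g2 g3 g4 g5 g6 g7 <;>
        simp at g0 g1 g2 g3 g4 g5 g6 g7 <;>
      first
        | exact ⟨m₀₁ + 1, m₁₂, m₂₃, m₀₃, l₀, l₁, l₂, l₃, by omega⟩
        | exact ⟨m₀₁, m₁₂ + 1, m₂₃, m₀₃, l₀, l₁, l₂, l₃, by omega⟩
        | exact ⟨m₀₁, m₁₂, m₂₃ + 1, m₀₃, l₀, l₁, l₂, l₃, by omega⟩
        | exact ⟨m₀₁, m₁₂, m₂₃, m₀₃ + 1, l₀, l₁, l₂, l₃, by omega⟩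
        | exact ⟨m₀₁, m₁₂, m₂₃, m₀₃, l₀ + 1, l₁, l₂, l₃, by omega⟩
        | exact ⟨m₀₁, m₁₂, m₂₃, m₀₃, l₀, l₁ + 1, l₂, l₃, by omega⟩
        | exact ⟨m₀₁, m₁₂, m₂₃, m₀₃, l₀, l₁, l₂ + 1, l₃, by omega⟩
        | exact ⟨m₀₁, m₁₂, m₂₃, m₀₃, l₀, l₁, l₂, l₃ + 1, by omega⟩
    · rintro ⟨m₀₁, m₁₂, m₂₃, m₀₃, l₀, l₁, l₂, l₃, hs, h0, h1, h2, h3, h4, h5, h6, h7⟩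
      have step : ∀ x y : Fin 8, ((x.val, y.val) ∈
          [(0,1),(1,2),(2,3),(0,3),(0,4),(1,5),(2,6),(3,7)]) → x ≠ y → 0 < a x → 0 < a y →
          memPow G16 q (fun j =>
            a j - ((if x = j then 1 else 0) + (if y = j then 1 else 0))) →
          ∃ x y b, G16.Adj x y ∧ memPow G16 q b ∧
            ∀ j, ((if x = j then 1 else 0) + (if y = j then 1 else 0)) + b j ≤ a j := by
        intro x y hxy hne hx hy h
        refine ⟨x, y, _, ⟨hne, Or.inl hxy⟩, h, fun j => ?_⟩
        split_ifs with h1 h2 h2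
        · exact absurd (h1.trans h2.symm) hne
        · subst h1; lia
        · subst h2; lia
        · lia
      have hpos : 0 < m₀₁ ∨ 0 < m₁₂ ∨ 0 < m₂₃ ∨ 0 < m₀₃ ∨ 0 < l₀ ∨ 0 < l₁ ∨ 0 < l₂ ∨ 0 < l₃ := by
        omega
      rcases hpos with h | h | h | h | h | h | h | h
      · refine step 0 1 (by decide) (by decide) (by omega) (by omega) ((ih _).2
          ⟨m₀₁ - 1, m₁₂, m₂₃, m₀₃, l₀, l₁, l₂, l₃, ?_⟩)
        simp
        omega
      · refine step 1 2 (by decide) (by decide) (by omega) (by omega) ((ih _).2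
          ⟨m₀₁, m₁₂ - 1, m₂₃, m₀₃, l₀, l₁, l₂, l₃, ?_⟩)
        simp
        omega
      · refine step 2 3 (by decide) (by decide) (by omega) (by omega) ((ih _).2
          ⟨m₀₁, m₁₂, m₂₃ - 1, m₀₃, l₀, l₁, l₂, l₃, ?_⟩)
        simp
        omega
      · refine step 0 3 (by decide) (by decide) (by omega) (by omega) ((ih _).2
          ⟨m₀₁, m₁₂, m₂₃, m₀₃ - 1, l₀, l₁, l₂, l₃, ?_⟩)
        simp
        omega
      · refine step 0 4 (by decide) (by decide) (by omega) (by omega) ((ih _).2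
          ⟨m₀₁, m₁₂, m₂₃, m₀₃, l₀ - 1, l₁, l₂, l₃, ?_⟩)
        simp
        omega
      · refine step 1 5 (by decide) (by decide) (by omega) (by omega) ((ih _).2
          ⟨m₀₁, m₁₂, m₂₃, m₀₃, l₀, l₁ - 1, l₂, l₃, ?_⟩)
        simp
        omega
      · refine step 2 6 (by decide) (by decide) (by omega) (by omega) ((ih _).2
          ⟨m₀₁, m₁₂, m₂₃, m₀₃, l₀, l₁, l₂ - 1, l₃, ?_⟩)
        simp
        omega
      · refine step 3 7 (by decide) (by decide) (by omega) (by omega) ((ih _).2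
          ⟨m₀₁, m₁₂, m₂₃, m₀₃, l₀, l₁, l₂, l₃ - 1, ?_⟩)
        simp
        omega

/-- Realizing a degree vector of total degree `2 * q` which saturates the vertices `0` and `2`:
the part of the degree of `0` and `2` not used by pendant edges is distributed on the cycle. -/
lemma memPow_G16_of_degrees {q : ℕ} {a : Fin 8 → ℕ} (h0 : a 4 ≤ a 0) (h1 : a 5 ≤ a 1)
    (h2 : a 6 ≤ a 2) (h3 : a 7 ≤ a 3)
    (hs : a 0 + a 2 + a 5 + a 7 = q) (hs' : a 1 + a 3 + a 4 + a 6 = q) : memPow G16 q a := by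
  rw [memPow_G16]
  refine ⟨min (a 0 - a 4) (a 1 - a 5), (a 1 - a 5) - min (a 0 - a 4) (a 1 - a 5),
    (a 3 - a 7) - ((a 0 - a 4) - min (a 0 - a 4) (a 1 - a 5)),
    (a 0 - a 4) - min (a 0 - a 4) (a 1 - a 5), a 4, a 5, a 6, a 7, ?_⟩
  omega

lemma deltaC_G16 (c : Fin 8 → ℕ)
    (h : (c 0 - c 4) + (c 2 - c 6) ≤ (c 1 - c 5) + (c 3 - c 7)) :
    deltaC G16 c = c 0 + c 2 + min (c 1) (c 5) + min (c 3) (c 7) := by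
  refine IsGreatest.csSup_eq ⟨?_, ?_⟩
  · set e := min (c 1 - c 5) ((c 0 - c 4) + (c 2 - c 6))
    set a : Fin 8 → ℕ := ![c 0, min (c 1) (c 5) + e, c 2,
      min (c 3) (c 7) + ((c 0 - c 4) + (c 2 - c 6) - e), min (c 0) (c 4), min (c 1) (c 5),
      min (c 2) (c 6), min (c 3) (c 7)]
    have a0 : a 0 = c 0 := rfl
    have a1 : a 1 = min (c 1) (c 5) + e := rfl
    have a2 : a 2 = c 2 := rfl
    have a3 : a 3 = min (c 3) (c 7) + ((c 0 - c 4) + (c 2 - c 6) - e) := rfl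
    have a4 : a 4 = min (c 0) (c 4) := rfl
    have a5 : a 5 = min (c 1) (c 5) := rfl
    have a6 : a 6 = min (c 2) (c 6) := rfl
    have a7 : a 7 = min (c 3) (c 7) := rfl
    clear_value a
    refine ⟨a, ?_, memPow_G16_of_degrees ?_ ?_ ?_ ?_ ?_ ?_⟩
    · simp [bdd, Fin.forall_fin_succ]
      omega
    all_goals omega
  · rintro q ⟨a, hb, hm⟩
    obtain ⟨m₀₁, m₁₂, m₂₃, m₀₃, l₀, l₁, l₂, l₃, hm⟩ := (memPow_G16 q a).1 hm
    have := hb 0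
    have := hb 1
    have := hb 2
    have := hb 3
    have := hb 4
    have := hb 5
    have := hb 6
    have := hb 7
    omega

lemma isVeronese_genW_G16 (c : Fin 8 → ℕ)
    (h : (c 0 - c 4) + (c 2 - c 6) ≤ (c 1 - c 5) + (c 3 - c 7)) :
    IsVeronese (genW G16 c) := by
  refine ⟨![c 0, min (c 1) (c 5), c 2, min (c 3) (c 7), 0, min (c 1) (c 5), 0, min (c 3) (c 7)],
    c 0 + c 2, ![0, c 1 - c 5, 0, c 3 - c 7, min (c 0) (c 4), 0, min (c 2) (c 6), 0], ?_, ?_⟩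
  · simp [Fin.sum_univ_succ]
    omega
  ext u
  simp only [genW, Set.mem_ofPred_eq, deltaC_G16 c h, funext_iff]
  constructor
  · rintro ⟨hb, hm, hmin⟩
    obtain ⟨m₀₁, m₁₂, m₂₃, m₀₃, l₀, l₁, l₂, l₃, hm⟩ := (memPow_G16 _ u).1 hm
    have key := hmin ![m₀₁ + m₀₃ + l₀, m₀₁ + m₁₂ + l₁, m₁₂ + m₂₃ + l₂, m₂₃ + m₀₃ + l₃,
      l₀, l₁, l₂, l₃] (by
        simp [bdd, Fin.forall_fin_succ]
        omega) ((memPow_G16 _ _).2 ⟨m₀₁, m₁₂, m₂₃, m₀₃, l₀, l₁, l₂, l₃, by simp [hm.1]⟩)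
    simp [Fin.forall_fin_succ] at key
    simp [bdd, Fin.forall_fin_succ] at hb
    refine ⟨![0, u 1 - min (c 1) (c 5), 0, u 3 - min (c 3) (c 7), u 4, 0, u 6, 0], ?_, ?_, ?_⟩
    · simp [Fin.forall_fin_succ]
      omega
    · simp [Fin.sum_univ_succ]
      omega
    · simp [Fin.forall_fin_succ]
      omega
  · rintro ⟨v, hv, hs, hu⟩
    simp [Fin.forall_fin_succ] at hv hu
    simp [Fin.sum_univ_succ] at hs
    refine ⟨?_, memPow_G16_of_degrees ?_ ?_ ?_ ?_ ?_ ?_, fun b hb hm => ?_⟩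
    · simp [bdd, Fin.forall_fin_succ]
      omega
    iterate 6 omega
    · obtain ⟨m₀₁, m₁₂, m₂₃, m₀₃, l₀, l₁, l₂, l₃, hm⟩ := (memPow_G16 _ b).1 hm
      simp [bdd, Fin.forall_fin_succ] at hb
      simp [Fin.forall_fin_succ]
      omega

/-- The rotation of the cycle, as an automorphism of `G16`. -/
def rotG16 : G16 ≃g G16 where
  toFun := ![1, 2, 3, 0, 5, 6, 7, 4]
  invFun := ![3, 0, 1, 2, 7, 4, 5, 6]
  left_inv := by decide
  right_inv := by decide
  map_rel_iff' := by
    simp only [G16, listGraph, SimpleGraph.fromRel_adj, Equiv.coe_fn_mk]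
    decide

/-- For every `c ∈ ℤ_{>0}^8`, the set `W(c,G16)` is of Veronese type;
in particular `G16` enjoys the strong exchange property. -/
theorem stmt16 :
    (∀ c : Fin 8 → ℕ, (∀ i, 0 < c i) → IsVeronese (genW G16 c)) ∧ SEP G16 := by
  have hV : ∀ c : Fin 8 → ℕ, IsVeronese (genW G16 c) := by
    intro c
    rcases le_total ((c 0 - c 4) + (c 2 - c 6)) ((c 1 - c 5) + (c 3 - c 7)) with h | h
    · exact isVeronese_genW_G16 c h
    · have := (isVeronese_genW_G16 (c ∘ rotG16) (by
        change (c 1 - c 5) + (c 3 - c 7) ≤ (c 2 - c 6) + (c 0 - c 4)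
        omega)).comp rotG16.toEquiv
      convert this using 1
      ext u
      exact (comp_mem_genW rotG16).symm
  exact ⟨fun c _ => hV c, fun c _ u hu v hv ξ ρ hξ hρ => (hV c).exch_mem hu hv hξ hρ⟩
end

section
/- Let $G$ be a unicyclic graph whose unique cycle has length $\ell \in \{5,6,7\}$. Then $G$ enjoys the strong exchange property if and only if the independence number of $G$ is at most three. -/
open Finset

/-- `w` is the degree vector of a multigraph supported on the edges of `G`, the multiplicities
being given by a symmetric matrix. -/
def IsDeg {n : ℕ} (G : SimpleGraph (Fin n)) (w : Fin n → ℕ) : Prop :=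
  ∃ m : Fin n → Fin n → ℕ, (∀ i j, m i j = m j i) ∧ (∀ i j, m i j ≠ 0 → G.Adj i j) ∧
    ∀ i, ∑ j, m i j = w i

/-- The multiplicity matrix of the single edge `xy`. -/
def edgeMat {n : ℕ} (x y a b : Fin n) : ℕ :=
  if (a = x ∧ b = y) ∨ (a = y ∧ b = x) then 1 else 0

lemma edgeMat_symm {n : ℕ} (x y a b : Fin n) : edgeMat x y a b = edgeMat x y b a := by
  unfold edgeMat; grind

lemma sum_edgeMat {n : ℕ} {x y : Fin n} (h : x ≠ y) (a : Fin n) :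
    ∑ b, edgeMat x y a b = (if x = a then 1 else 0) + (if y = a then 1 else 0) := by
  have h1 : ∀ b, edgeMat x y a b =
      (if b = y then (if x = a then 1 else 0) else 0) +
        (if b = x then (if y = a then 1 else 0) else 0) := by
    intro b; unfold edgeMat; grind
  simp only [h1, Finset.sum_add_distrib, Finset.sum_ite_eq', Finset.mem_univ, if_true]

lemma IsDeg.congr {n : ℕ} {G : SimpleGraph (Fin n)} {w w' : Fin n → ℕ} (h : IsDeg G w)
    (e : ∀ i, w i = w' i) : IsDeg G w' := (funext e : w = w') ▸ h

lemma isDeg_zero {n : ℕ} (G : SimpleGraph (Fin n)) : IsDeg G (fun _ => 0) :=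
  ⟨fun _ _ => 0, by simp, by simp, by simp⟩

lemma IsDeg.add {n : ℕ} {G : SimpleGraph (Fin n)} {w w' : Fin n → ℕ} (h : IsDeg G w)
    (h' : IsDeg G w') : IsDeg G (fun i => w i + w' i) := by
  obtain ⟨m, hs, ha, hd⟩ := h
  obtain ⟨m', hs', ha', hd'⟩ := h'
  refine ⟨fun i j => m i j + m' i j, fun i j => by simp only [hs i j, hs' i j], fun i j hij => ?_,
    fun i => ?_⟩
  · dsimp only at hij
    by_cases h0 : m i j = 0
    · exact ha' i j (by omega)
    · exact ha i j h0
  · rw [Finset.sum_add_distrib, hd, hd']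

lemma isDeg_edge {n : ℕ} {G : SimpleGraph (Fin n)} {x y : Fin n} (h : G.Adj x y) :
    IsDeg G (fun i => (if x = i then 1 else 0) + (if y = i then 1 else 0)) := by
  refine ⟨edgeMat x y, edgeMat_symm x y, fun i j hij => ?_, sum_edgeMat h.ne⟩
  unfold edgeMat at hij
  split_ifs at hij with hc
  · rcases hc with ⟨rfl, rfl⟩ | ⟨rfl, rfl⟩
    exacts [h, h.symm]
  · exact absurd rfl hij

lemma isDeg_sum {n : ℕ} {G : SimpleGraph (Fin n)} {ι : Type*} (s : Finset ι)
    (w : ι → Fin n → ℕ) (h : ∀ t ∈ s, IsDeg G (w t)) : IsDeg G (fun i => ∑ t ∈ s, w t i) := by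
  classical
  induction s using Finset.induction_on with
  | empty => simpa using isDeg_zero G
  | insert a s ha ih =>
    have h1 := (h a (by simp)).add (ih fun t ht => h t (by simp [ht]))
    exact h1.congr fun i => by rw [Finset.sum_insert ha]

lemma exists_edges_of_isDeg {n : ℕ} {G : SimpleGraph (Fin n)} {w : Fin n → ℕ}
    (h : IsDeg G w) : ∃ q, ∃ e : Fin q → Fin n × Fin n, (∀ i, G.Adj (e i).1 (e i).2) ∧
      ∀ j, (∑ i, ((if (e i).1 = j then 1 else 0) + (if (e i).2 = j then 1 else 0))) = w j := by
  obtain ⟨m, hs, ha, hd⟩ := h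
  induction hN : ∑ i, ∑ j, m i j using Nat.strong_induction_on generalizing m w with
  | _ N ih =>
  by_cases h0 : ∀ i j, m i j = 0
  · refine ⟨0, Fin.elim0, fun i => i.elim0, fun j => ?_⟩
    rw [← hd j]; simp [h0]
  push Not at h0
  obtain ⟨x, y, hxy⟩ := h0
  have hadj := ha x y hxy
  have hle : ∀ a b, edgeMat x y a b ≤ m a b := by
    intro a b
    unfold edgeMat
    split_ifs with hc
    · rcases hc with ⟨rfl, rfl⟩ | ⟨rfl, rfl⟩
      · omega
      · rw [hs]; omega
    · omega
  have hdeg : ∀ a, ∑ b, (m a b - edgeMat x y a b) + ∑ b, edgeMat x y a b = w a := by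
    intro a
    rw [← Finset.sum_add_distrib, ← hd a]
    exact Finset.sum_congr rfl fun b _ => Nat.sub_add_cancel (hle a b)
  obtain ⟨q, e, he, hw⟩ := ih (∑ a, ∑ b, (m a b - edgeMat x y a b)) (by
      rw [← hN]
      refine Finset.sum_lt_sum (fun a _ => Finset.sum_le_sum fun b _ => Nat.sub_le _ _)
        ⟨x, Finset.mem_univ _, Finset.sum_lt_sum (fun b _ => Nat.sub_le _ _)
          ⟨y, Finset.mem_univ _, ?_⟩⟩
      have : edgeMat x y x y = 1 := by simp [edgeMat]
      omega)
    (fun a b => m a b - edgeMat x y a b) (w := fun a => ∑ b, (m a b - edgeMat x y a b))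
    (fun a b => by rw [hs, edgeMat_symm]) (fun a b hab => ha a b (by omega)) (fun _ => rfl) rfl
  refine ⟨q + 1, Fin.cons (x, y) e, fun i => ?_, fun j => ?_⟩
  · refine Fin.cases ?_ (fun i => ?_) i
    · exact hadj
    · exact he i
  · rw [Fin.sum_univ_succ]
    simp only [Fin.cons_zero, Fin.cons_succ]
    rw [hw j, ← hdeg j, sum_edgeMat hadj.ne]
    ring

lemma sum_edges {n q : ℕ} (e : Fin q → Fin n × Fin n) :
    ∑ j, (∑ i, ((if (e i).1 = j then 1 else 0) + (if (e i).2 = j then 1 else 0))) = 2 * q := by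
  rw [Finset.sum_comm]
  simp [Finset.sum_add_distrib]
  ring

lemma memPow_iff {n : ℕ} {G : SimpleGraph (Fin n)} {q : ℕ} {a : Fin n → ℕ} :
    memPow G q a ↔ ∃ w, IsDeg G w ∧ ∑ i, w i = 2 * q ∧ ∀ i, w i ≤ a i := by
  constructor
  · rintro ⟨e, he, hle⟩
    exact ⟨_, isDeg_sum Finset.univ _ fun i _ => isDeg_edge (he i), sum_edges e, hle⟩
  · rintro ⟨w, hw, hs, hle⟩
    obtain ⟨q', e, he, hd⟩ := exists_edges_of_isDeg hw
    have h2 := sum_edges e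
    simp only [hd] at h2
    obtain rfl : q' = q := by omega
    exact ⟨e, he, fun j => (hd j).trans_le (hle j)⟩

lemma IsDeg.even {n : ℕ} {G : SimpleGraph (Fin n)} {w : Fin n → ℕ} (h : IsDeg G w) :
    ∃ q, ∑ i, w i = 2 * q := by
  obtain ⟨q, e, -, hd⟩ := exists_edges_of_isDeg h
  refine ⟨q, ?_⟩
  rw [← sum_edges e]
  simp only [hd]

lemma mem_genW_iff {n : ℕ} {G : SimpleGraph (Fin n)} {c u : Fin n → ℕ} :
    u ∈ genW G c ↔ bdd c u ∧ IsDeg G u ∧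
      ∀ w, bdd c w → IsDeg G w → ∑ i, w i ≤ ∑ i, u i := by
  have hbd : BddAbove {q | ∃ a, bdd c a ∧ memPow G q a} := by
    refine ⟨∑ i, c i, ?_⟩
    rintro q ⟨a, hb, hm⟩
    obtain ⟨w, -, hs, hle⟩ := memPow_iff.1 hm
    have : ∑ i, w i ≤ ∑ i, c i := Finset.sum_le_sum fun i _ => (hle i).trans (hb i)
    omega
  have hne : {q | ∃ a, bdd c a ∧ memPow G q a}.Nonempty :=
    ⟨0, fun _ => 0, fun _ => Nat.zero_le _,
      memPow_iff.2 ⟨_, isDeg_zero G, by simp, fun _ => le_rfl⟩⟩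
  have hmax : ∀ w, bdd c w → IsDeg G w → ∑ i, w i ≤ 2 * deltaC G c := by
    intro w hb hw
    obtain ⟨q, hq⟩ := hw.even
    have : q ≤ deltaC G c := le_csSup hbd ⟨w, hb, memPow_iff.2 ⟨w, hw, hq, fun _ => le_rfl⟩⟩
    omega
  constructor
  · rintro ⟨hb, hm, hmin⟩
    obtain ⟨w, hw, hs, hle⟩ := memPow_iff.1 hm
    obtain rfl := hmin w hle (memPow_iff.2 ⟨w, hw, hs, fun _ => le_rfl⟩)
    exact ⟨hb, hw, fun w' hb' hw' => hs ▸ hmax w' hb' hw'⟩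
  · rintro ⟨hb, hu, hm⟩
    have hs : ∑ i, u i = 2 * deltaC G c := by
      refine le_antisymm (hmax u hb hu) ?_
      obtain ⟨a, hba, hma⟩ := Nat.sSup_mem hne hbd
      obtain ⟨w, hw, hsw, hle⟩ := memPow_iff.1 hma
      exact hsw ▸ hm w (fun i => (hle i).trans (hba i)) hw
    refine ⟨hb, memPow_iff.2 ⟨u, hu, hs, fun _ => le_rfl⟩, fun b hbu hmb => ?_⟩
    obtain ⟨w, hw, hsw, hle⟩ := memPow_iff.1 hmb
    have hwu : ∀ i ∈ Finset.univ, w i = u i :=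
      (Finset.sum_eq_sum_iff_of_le fun i _ => (hle i).trans (hbu i)).1 (hsw.trans hs.symm)
    funext i
    exact le_antisymm (hbu i) ((hwu i (Finset.mem_univ i)) ▸ hle i)

lemma exch_apply_self {n : ℕ} (u : Fin n → ℕ) (ξ ρ : Fin n) : exch u ξ ρ ρ = u ρ + 1 := by
  simp [exch]

lemma exch_apply_left {n : ℕ} (u : Fin n → ℕ) {ξ ρ : Fin n} (h : ξ ≠ ρ) :
    exch u ξ ρ ξ = u ξ - 1 := by
  simp [exch, h]

lemma exch_apply_of_ne {n : ℕ} (u : Fin n → ℕ) {ξ ρ i : Fin n} (h : i ≠ ξ) (h' : i ≠ ρ) :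
    exch u ξ ρ i = u i := by
  simp [exch, h, h']

lemma exch_add {n : ℕ} {u : Fin n → ℕ} {ξ ρ : Fin n} (h : 0 < u ξ) (hne : ξ ≠ ρ) (i : Fin n) :
    exch u ξ ρ i + (if ξ = i then 1 else 0) = u i + (if ρ = i then 1 else 0) := by
  unfold exch; grind

lemma sum_exch {n : ℕ} {u : Fin n → ℕ} {ξ ρ : Fin n} (h : 0 < u ξ) (hne : ξ ≠ ρ) :
    ∑ i, exch u ξ ρ i = ∑ i, u i := by
  have h1 := Finset.sum_congr (rfl : (Finset.univ : Finset (Fin n)) = _)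
    fun i _ => exch_add h hne i
  simp only [Finset.sum_add_distrib, Finset.sum_ite_eq, Finset.mem_univ, if_true] at h1
  omega

lemma exch_exch {n : ℕ} {u : Fin n → ℕ} {y j i : Fin n} (hyj : y ≠ j) (hij : i ≠ j)
    (hiy : i ≠ y) (h : 0 < u y) : exch (exch u y j) i y = exch u i j := by
  funext a
  unfold exch; grind

/-- Moving one unit of multiplicity from the edge `xy` to the edge `jx`. -/
lemma isDeg_exch_move {n : ℕ} {G : SimpleGraph (Fin n)} {m : Fin n → Fin n → ℕ}
    (hs : ∀ a b, m a b = m b a) (ha : ∀ a b, m a b ≠ 0 → G.Adj a b) {j x y : Fin n}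
    (hjx : G.Adj j x) (hxy : 0 < m x y) (hyj : y ≠ j) :
    ∃ m' : Fin n → Fin n → ℕ, (∀ a b, m' a b = m' b a) ∧ (∀ a b, m' a b ≠ 0 → G.Adj a b) ∧
      (∀ a, ∑ b, m' a b = exch (fun a => ∑ b, m a b) y j a) ∧
      ∀ a b, m' a b + edgeMat x y a b = m a b + edgeMat j x a b := by
  have hxy' := ha x y hxy.ne'
  have hle : ∀ a b, edgeMat x y a b ≤ m a b := by
    intro a b
    unfold edgeMat
    split_ifs with hc
    · rcases hc with ⟨rfl, rfl⟩ | ⟨rfl, rfl⟩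
      · omega
      · rw [hs]; omega
    · omega
  have key : ∀ a b, m a b - edgeMat x y a b + edgeMat j x a b + edgeMat x y a b =
      m a b + edgeMat j x a b := fun a b => by have := hle a b; omega
  refine ⟨fun a b => m a b - edgeMat x y a b + edgeMat j x a b, fun a b => ?_, fun a b hab => ?_,
    fun a => ?_, key⟩
  · simp only [hs a b, edgeMat_symm _ _ a b]
  · by_cases h0 : m a b = 0
    · have h1 : edgeMat j x a b ≠ 0 := by
        dsimp only at hab; omega
      unfold edgeMat at h1
      split_ifs at h1 with hc
      · rcases hc with ⟨rfl, rfl⟩ | ⟨rfl, rfl⟩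
        exacts [hjx, hjx.symm]
      · exact absurd rfl h1
    · exact ha a b h0
  · have h1 := Finset.sum_congr (rfl : (Finset.univ : Finset (Fin n)) = _) fun b _ => key a b
    rw [Finset.sum_add_distrib, Finset.sum_add_distrib (f := fun b => m a b),
      sum_edgeMat hxy'.ne, sum_edgeMat hjx.ne] at h1
    have hpos : 0 < ∑ b, m y b :=
      Finset.sum_pos' (fun _ _ => Nat.zero_le _) ⟨x, Finset.mem_univ _, by rw [hs]; exact hxy⟩
    have h2 := exch_add (u := fun a => ∑ b, m a b) hpos hyj a
    dsimp only at h1 h2 ⊢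
    omega

lemma exch_mem_genW {n : ℕ} {G : SimpleGraph (Fin n)} {c u : Fin n → ℕ} {ξ ρ : Fin n}
    (hu : u ∈ genW G c) (hne : ξ ≠ ρ) (hpos : 0 < u ξ) (hρ : u ρ < c ρ)
    (hd : IsDeg G (exch u ξ ρ)) : exch u ξ ρ ∈ genW G c := by
  rw [mem_genW_iff] at hu ⊢
  obtain ⟨hb, -, hm⟩ := hu
  refine ⟨fun i => ?_, hd, fun w hw hw' => (sum_exch hpos hne).symm ▸ hm w hw hw'⟩
  have := hb i
  unfold exch
  split_ifs with h1 h2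
  · subst h1; omega
  · omega
  · omega

/-- Two vertices that are both unsaturated by a maximal element are not adjacent. -/
lemma not_adj_of_lt {n : ℕ} {G : SimpleGraph (Fin n)} {c u : Fin n → ℕ} (hu : u ∈ genW G c)
    {a b : Fin n} (ha : u a < c a) (hb : u b < c b) : ¬ G.Adj a b := by
  intro hab
  obtain ⟨hbd, hd, hm⟩ := mem_genW_iff.1 hu
  have h1 := hm _ (fun i => ?_) (hd.add (isDeg_edge hab))
  · simp only [Finset.sum_add_distrib, Finset.sum_ite_eq, Finset.mem_univ, if_true] at h1
    omega
  · have := hbd i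
    split_ifs with h1 h2 h2
    · exact absurd (h1.trans h2.symm) hab.ne
    · subst h1; omega
    · subst h2; omega
    · omega

/-- The exchange property, proved by following an alternating walk. -/
lemma genW_exchange {n : ℕ} {G : SimpleGraph (Fin n)} {c u v : Fin n → ℕ} (hu : u ∈ genW G c)
    (hv : v ∈ genW G c) {j : Fin n} (hj : u j < v j) :
    ∃ i, v i < u i ∧ exch u i j ∈ genW G c := by
  obtain ⟨m, hs, ha, hd⟩ := (mem_genW_iff.1 hu).2.1
  obtain ⟨p, hs', ha', hd'⟩ := (mem_genW_iff.1 hv).2.1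
  induction hN : ∑ a, ∑ b, (p a b - m a b) using Nat.strong_induction_on
    generalizing m u j with
  | _ N ih =>
  have hcu := (mem_genW_iff.1 hu).1
  have hcv := (mem_genW_iff.1 hv).1
  obtain ⟨x, -, hx⟩ : ∃ x ∈ Finset.univ, m j x < p j x := by
    apply Finset.exists_lt_of_sum_lt
    rwa [hd, hd']
  have hjx : G.Adj j x := ha' j x (by omega)
  have hux : u x = c x := by
    by_contra hne
    exact not_adj_of_lt hu (hj.trans_le (hcv j)) (lt_of_le_of_ne (hcu x) hne) hjx
  obtain ⟨y, -, hy⟩ : ∃ y ∈ Finset.univ, p x y < m x y := by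
    by_contra! hcon
    have h1 : ∑ b, m x b < ∑ b, p x b :=
      Finset.sum_lt_sum hcon ⟨j, Finset.mem_univ _, by rw [hs x j, hs' x j]; exact hx⟩
    rw [hd, hd'] at h1
    have := hcv x
    omega
  have hyj : y ≠ j := by
    rintro rfl
    rw [hs x y, hs' x y] at hy
    omega
  obtain ⟨m', ms, ma, md, mk⟩ := isDeg_exch_move hs ha hjx (by omega : 0 < m x y) hyj
  simp only [hd] at md
  have huy : 0 < u y := by
    rw [← hd y]
    exact Finset.sum_pos' (fun _ _ => Nat.zero_le _) ⟨x, Finset.mem_univ _, by rw [hs]; omega⟩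
  have hu' : exch u y j ∈ genW G c :=
    exch_mem_genW hu hyj huy (hj.trans_le (hcv j)) ⟨m', ms, ma, md⟩
  by_cases hvy : v y < u y
  · exact ⟨y, hvy, hu'⟩
  have hxy : x ≠ y := (ha x y (by omega)).ne
  have hle : ∀ a b, p a b - m' a b ≤ p a b - m a b := by
    intro a b
    have h1 := mk a b
    unfold edgeMat at h1
    split_ifs at h1 with h2 h3 h3
    · omega
    · rcases h2 with ⟨rfl, rfl⟩ | ⟨rfl, rfl⟩
      · omega
      · have := hs a b; have := hs' a b
        omega
    · omega
    · omega
  obtain ⟨i, hi, hex⟩ := ih _ (by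
      rw [← hN]
      refine Finset.sum_lt_sum (fun a _ => Finset.sum_le_sum fun b _ => hle a b)
        ⟨j, Finset.mem_univ _, Finset.sum_lt_sum (fun b _ => hle j b) ⟨x, Finset.mem_univ _, ?_⟩⟩
      have h1 := mk j x
      have h2 : edgeMat x y j x = 0 := by
        unfold edgeMat
        rw [if_neg]
        rintro (⟨h, -⟩ | ⟨h, -⟩)
        · exact hjx.ne h
        · exact hyj h.symm
      have h3 : edgeMat j x j x = 1 := by simp [edgeMat]
      omega)
    hu' (j := y) (by rw [exch_apply_left u hyj]; omega) m' ms ma md rfl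
  have hij : i ≠ j := by
    rintro rfl
    rw [exch_apply_self] at hi
    omega
  have hiy : i ≠ y := by
    rintro rfl
    rw [exch_apply_left u hyj] at hi
    omega
  rw [exch_exch hyj hij hiy huy] at hex
  rw [exch_apply_of_ne u hiy hij] at hi
  exact ⟨i, hi, hex⟩

/-- The exchange property in the dual direction. -/
lemma genW_exchange' {n : ℕ} {G : SimpleGraph (Fin n)} {c u v : Fin n → ℕ} (hu : u ∈ genW G c)
    (hv : v ∈ genW G c) {i : Fin n} (hi : v i < u i) :
    ∃ j, u j < v j ∧ exch u i j ∈ genW G c := by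
  induction hN : ∑ k, (u k - v k) using Nat.strong_induction_on generalizing v with
  | _ N ih =>
  by_cases hk : ∃ k, v k < u k ∧ (k ≠ i ∨ v k + 1 < u k)
  · obtain ⟨k, hk, hki⟩ := hk
    obtain ⟨j, hj, hv'⟩ := genW_exchange hv hu hk
    have hjk : j ≠ k := by rintro rfl; omega
    have hle : ∀ a, u a - exch v j k a ≤ u a - v a := by
      intro a; unfold exch; grind
    obtain ⟨j', hj', hex⟩ := ih _ (by
        rw [← hN]
        refine Finset.sum_lt_sum (fun a _ => hle a) ⟨k, Finset.mem_univ _, ?_⟩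
        rw [exch_apply_self]; omega) hv' (by unfold exch; grind) rfl
    refine ⟨j', ?_, hex⟩
    revert hj'
    unfold exch; grind
  · push Not at hk
    have hsum : ∑ k, u k = ∑ k, v k :=
      le_antisymm ((mem_genW_iff.1 hv).2.2 u (mem_genW_iff.1 hu).1 (mem_genW_iff.1 hu).2.1)
        ((mem_genW_iff.1 hu).2.2 v (mem_genW_iff.1 hv).1 (mem_genW_iff.1 hv).2.1)
    obtain ⟨j, hj⟩ : ∃ j, u j < v j := by
      by_contra! hcon
      have := Finset.sum_lt_sum (fun a (_ : a ∈ Finset.univ) => hcon a) ⟨i, Finset.mem_univ _, hi⟩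
      omega
    obtain ⟨i', hi', hex⟩ := genW_exchange hu hv hj
    have : i' = i := by
      by_contra hne
      exact absurd (hk i' hi').1 hne
    exact ⟨j, hj, this ▸ hex⟩

/-- If the strong exchange property fails in a graph of independence number at most three, then
there are two maximal elements, each leaving unsaturated a vertex of an edge `xy` whose ends can be
exchanged for one another, together with a further vertex, and these further vertices differ. -/
lemma exists_edge_of_not_exch {n : ℕ} {G : SimpleGraph (Fin n)} {c u v : Fin n → ℕ}
    (hα : ∀ s : Finset (Fin n), (∀ i ∈ s, ∀ j ∈ s, ¬ G.Adj i j) → s.card ≤ 3)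
    (hu : u ∈ genW G c) (hv : v ∈ genW G c) {ξ ρ : Fin n} (hξ : v ξ < u ξ) (hρ : u ρ < v ρ)
    (hex : exch u ξ ρ ∉ genW G c) :
    ∃ x y j i u w, G.Adj x y ∧ i ≠ j ∧
      (u ∈ genW G c ∧ exch u y x ∈ genW G c ∧ u x < c x ∧ u j < c j ∧ j ≠ x) ∧
      (w ∈ genW G c ∧ exch w x y ∈ genW G c ∧ w y < c y ∧ w i < c i ∧ i ≠ y) := by
  have bd : ∀ {w : Fin n → ℕ}, w ∈ genW G c → ∀ i, w i ≤ c i := fun h => (mem_genW_iff.1 h).1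
  obtain ⟨k, hk, huk⟩ := genW_exchange hu hv hρ
  have hkξ : k ≠ ξ := by rintro rfl; exact hex huk
  obtain ⟨j, hj, huj⟩ := genW_exchange' hu hv hξ
  have hjρ : j ≠ ρ := by rintro rfl; exact hex huj
  have hkρ : k ≠ ρ := by rintro rfl; omega
  have hkj : k ≠ j := by rintro rfl; omega
  have hξρ : ξ ≠ ρ := by rintro rfl; omega
  have hξj : ξ ≠ j := by rintro rfl; omega
  have bu := bd hu
  have bv := bd hv
  have hck := bu k
  have hcξ := bu ξ
  have hcj := bv j
  have hcρ := bv ρ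
  have n1 : ¬ G.Adj ρ j := not_adj_of_lt hu (by omega) (by omega)
  have n2 : ¬ G.Adj ξ k := not_adj_of_lt hv (by omega) (by omega)
  have n3 : ¬ G.Adj ρ ξ := not_adj_of_lt huj (by rw [exch_apply_of_ne u hξρ.symm hjρ.symm]; omega)
    (by rw [exch_apply_left u hξj]; omega)
  have n4 : ¬ G.Adj j k := not_adj_of_lt huk (by rw [exch_apply_of_ne u hkj.symm hjρ]; omega)
    (by rw [exch_apply_left u hkρ]; omega)
  by_cases hρk : G.Adj ρ k
  · have hsat : u ρ + 1 = c ρ := by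
      by_contra hne
      exact not_adj_of_lt huk (by rw [exch_apply_self]; omega)
        (by rw [exch_apply_left u hkρ]; omega) hρk
    obtain ⟨j', hj', hw⟩ := genW_exchange' huk hv (i := ξ)
      (by rw [exch_apply_of_ne u hkξ.symm hξρ]; exact hξ)
    have hj'ρ : j' ≠ ρ := by
      rintro rfl
      rw [exch_apply_self] at hj'; omega
    have hj'k : j' ≠ k := by
      rintro rfl
      rw [exch_apply_left u hkρ] at hj'
      omega
    have hj'ξ : j' ≠ ξ := by
      rintro rfl
      rw [exch_apply_of_ne u hkξ.symm hξρ] at hj'; omega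
    rw [exch_apply_of_ne u hj'k hj'ρ] at hj'
    have hcj' := bv j'
    have wk : exch (exch u k ρ) ξ j' k = u k - 1 := by
      rw [exch_apply_of_ne _ hkξ hj'k.symm, exch_apply_left u hkρ]
    have wξ : exch (exch u k ρ) ξ j' ξ = u ξ - 1 := by
      rw [exch_apply_left _ hj'ξ.symm, exch_apply_of_ne u hkξ.symm hξρ]
    have wρ : exch (exch u k ρ) ξ j' ρ = u ρ + 1 := by
      rw [exch_apply_of_ne _ hξρ.symm hj'ρ.symm, exch_apply_self]
    obtain ⟨i', hi', hw'⟩ := genW_exchange' hw hu (i := ρ) (by omega)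
    have hi'k : i' = k := by
      by_contra hne
      by_cases hi'ρ : i' = ρ
      · subst hi'ρ; omega
      refine not_adj_of_lt hw' ?_ ?_ hρk
      · rw [exch_apply_left _ (Ne.symm hi'ρ)]; omega
      · rw [exch_apply_of_ne _ hkρ (Ne.symm hne)]; omega
    subst hi'k
    exact ⟨ρ, i', j', ξ, u, _, hρk, hj'ξ.symm, ⟨hu, huk, by omega, by omega, hj'ρ⟩,
      ⟨hw, hw', by omega, by omega, hkξ.symm⟩⟩
  by_cases hjξ : G.Adj j ξ
  · have hsat : u j + 1 = c j := by
      by_contra hne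
      exact not_adj_of_lt huj (by rw [exch_apply_self]; omega)
        (by rw [exch_apply_left u hξj]; omega) hjξ
    obtain ⟨i, hi, hw⟩ := genW_exchange huj hv (j := ρ)
      (by rw [exch_apply_of_ne u hξρ.symm hjρ.symm]; exact hρ)
    have hiρ : i ≠ ρ := by
      rintro rfl
      rw [exch_apply_of_ne u hξρ.symm hjρ.symm] at hi; omega
    have hij : i ≠ j := by
      rintro rfl
      rw [exch_apply_self] at hi; omega
    have wj : exch (exch u ξ j) i ρ j = u j + 1 := by
      rw [exch_apply_of_ne _ hij.symm hjρ, exch_apply_self]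
    have wξ : exch (exch u ξ j) i ρ ξ ≤ u ξ - 1 := by
      rw [← exch_apply_left u hξj]
      unfold exch; grind
    obtain ⟨i', hi', hw'⟩ := genW_exchange' hw hu (i := j) (by omega)
    have hi'ξ : i' = ξ := by
      by_contra hne
      by_cases hi'j : i' = j
      · subst hi'j; omega
      refine not_adj_of_lt hw' ?_ ?_ hjξ
      · rw [exch_apply_left _ (Ne.symm hi'j)]; omega
      · rw [exch_apply_of_ne _ hξj (Ne.symm hne)]; omega
    subst hi'ξ
    have hiξ : i ≠ i' := by
      rintro rfl
      have h1 := bd hw' i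
      rw [exch_apply_self, exch_apply_left _ hiρ, exch_apply_left _ hξj] at h1
      refine not_adj_of_lt hw' ?_ ?_ hjξ
      · rw [exch_apply_left _ hξj.symm]; omega
      · rw [exch_apply_self, exch_apply_left _ hiρ, exch_apply_left _ hξj]
        rw [exch_apply_left _ hξj] at hi
        omega
    have wi : exch (exch u i' j) i ρ i < c i := by
      have := bu i
      rw [exch_apply_left _ hiρ, exch_apply_of_ne u hiξ hij]
      rw [exch_apply_of_ne u hiξ hij] at hi
      omega
    exact ⟨j, i', ρ, i, u, _, hjξ, hiρ, ⟨hu, huj, by omega, by omega, hjρ.symm⟩,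
      ⟨hw, hw', by omega, wi, hiξ⟩⟩
  · exfalso
    have hcard : ({ρ, j, ξ, k} : Finset (Fin n)).card = 4 := by
      rw [Finset.card_insert_of_notMem, Finset.card_insert_of_notMem,
        Finset.card_insert_of_notMem, Finset.card_singleton]
      · simpa using hkξ.symm
      · simpa using ⟨hξj.symm, hkj.symm⟩
      · simpa using ⟨hjρ.symm, hξρ.symm, hkρ.symm⟩
    have := hα {ρ, j, ξ, k} (by
      simp only [Finset.mem_insert, Finset.mem_singleton]
      have := fun a b => G.adj_comm a b
      have := fun a => G.irrefl (v := a)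
      rintro a (rfl | rfl | rfl | rfl) b (rfl | rfl | rfl | rfl) <;> grind)
    omega

/-- A graph of independence number at most three has the strong exchange property as soon as its
odd even-degree multigraphs can be completed to all degree vectors missing one vertex of `C`,
and at most one vertex has no neighbour in `C`. -/
structure Good {n : ℕ} (G : SimpleGraph (Fin n)) (C : Set (Fin n)) : Prop where
  indep : ∀ s : Finset (Fin n), (∀ i ∈ s, ∀ j ∈ s, ¬ G.Adj i j) → s.card ≤ 3
  odd : ∀ g : Fin n → ℕ, Odd (∑ i, g i) → IsDeg G (fun i => 2 * g i) → ∀ z ∈ C,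
    ∃ w, IsDeg G w ∧ ∀ i, w i + (if z = i then 1 else 0) = g i
  far : ∀ a b, a ≠ b → (∃ z ∈ C, G.Adj z a) ∨ ∃ z ∈ C, G.Adj z b

lemma Good.false_of_adj {n : ℕ} {G : SimpleGraph (Fin n)} {C : Set (Fin n)} (h : Good G C)
    {c u : Fin n → ℕ} {x y z j : Fin n} (hxy : G.Adj x y) (hu : u ∈ genW G c)
    (hu' : exch u y x ∈ genW G c) (hx : u x < c x) (hj : u j < c j) (hjx : j ≠ x)
    (hz : z ∈ C) (hzj : G.Adj z j) : False := by
  obtain ⟨hb, hd, hm⟩ := mem_genW_iff.1 hu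
  have hd' := (mem_genW_iff.1 hu').2.1
  have hpos : 0 < u y := by
    by_contra h0
    have hsum : ∑ i, exch u y x i = ∑ i, u i + 1 := by
      have : ∀ i, exch u y x i = u i + (if x = i then 1 else 0) := by
        intro i; unfold exch; grind
      simp [this, Finset.sum_add_distrib]
    obtain ⟨q, hq⟩ := hd.even
    obtain ⟨q', hq'⟩ := hd'.even
    omega
  obtain ⟨w, hw, hwz⟩ := h.odd (fun i => u i + if x = i then 1 else 0) (by
      obtain ⟨q, hq⟩ := hd.even
      refine ⟨q, ?_⟩
      rw [Finset.sum_add_distrib, hq]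
      simp) (((hd.add hd').add (isDeg_edge hxy)).congr fun i => by
        have := exch_add (ξ := y) (ρ := x) hpos hxy.ne.symm i
        omega) z hz
  have key : ∀ i, w i + ((if z = i then 1 else 0) + (if j = i then 1 else 0)) =
      u i + ((if x = i then 1 else 0) + (if j = i then 1 else 0)) := fun i => by
    have := hwz i
    omega
  have h1 := hm _ (fun i => ?_) (hw.add (isDeg_edge hzj))
  · simp only [key, Finset.sum_add_distrib, Finset.sum_ite_eq, Finset.mem_univ, if_true] at h1
    omega
  · have := hb i
    rw [key i]
    split_ifs with h1 h2 h2
    · exact absurd (h2.trans h1.symm) hjx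
    · subst h1; omega
    · subst h2; omega
    · omega

lemma Good.sep {n : ℕ} {G : SimpleGraph (Fin n)} {C : Set (Fin n)} (h : Good G C) : SEP G := by
  intro c _ u hu v hv ξ ρ hξ hρ
  by_contra hex
  obtain ⟨x, y, j, i, u, w, hxy, hij, ⟨h1, h2, h3, h4, h5⟩, h6, h7, h8, h9, h10⟩ :=
    exists_edge_of_not_exch h.indep hu hv hξ hρ hex
  rcases h.far i j hij with ⟨z, hz, hzi⟩ | ⟨z, hz, hzj⟩
  · exact h.false_of_adj hxy.symm h6 h7 h8 h9 h10 hz hzi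
  · exact h.false_of_adj hxy h1 h2 h3 h4 h5 hz hzj

/-- Two disjoint paths `p₁ t₁ p₂` and `q t₂ r` with independent ends, such that `t₂` is adjacent to
neither `p₁` nor `p₂`. -/
def HasTwoCherries {n : ℕ} (G : SimpleGraph (Fin n)) : Prop :=
  ∃ p₁ p₂ q r t₁ t₂, p₁ ≠ p₂ ∧ q ≠ r ∧ G.Adj t₁ p₁ ∧ G.Adj t₁ p₂ ∧ G.Adj t₂ q ∧ G.Adj t₂ r ∧
    ¬ G.Adj t₂ p₁ ∧ ¬ G.Adj t₂ p₂ ∧ ¬ G.Adj p₁ p₂ ∧ ¬ G.Adj p₁ q ∧ ¬ G.Adj p₁ r ∧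
    ¬ G.Adj p₂ q ∧ ¬ G.Adj p₂ r ∧ ¬ G.Adj q r

lemma indep_of_cherries {n : ℕ} {G : SimpleGraph (Fin n)} {p₁ p₂ q r : Fin n}
    (h1 : ¬ G.Adj p₁ p₂) (h2 : ¬ G.Adj p₁ q) (h3 : ¬ G.Adj p₁ r) (h4 : ¬ G.Adj p₂ q)
    (h5 : ¬ G.Adj p₂ r) (h6 : ¬ G.Adj q r) :
    ∀ i ∈ ({p₁, p₂, q, r} : Finset (Fin n)), ∀ j ∈ ({p₁, p₂, q, r} : Finset (Fin n)),
      ¬ G.Adj i j := by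
  simp only [Finset.mem_insert, Finset.mem_singleton]
  have := fun a b => G.adj_comm a b
  have := fun a => G.irrefl (v := a)
  rintro a (rfl | rfl | rfl | rfl) b (rfl | rfl | rfl | rfl) <;> grind

lemma HasTwoCherries.exists_indep {n : ℕ} {G : SimpleGraph (Fin n)} (h : HasTwoCherries G) :
    ∃ s : Finset (Fin n), (∀ i ∈ s, ∀ j ∈ s, ¬ G.Adj i j) ∧ s.card = 4 := by
  obtain ⟨p₁, p₂, q, r, t₁, t₂, hp, hq, -, -, a3, a4, a5, a6, h1, h2, h3, h4, h5, h6⟩ := h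
  refine ⟨_, indep_of_cherries h1 h2 h3 h4 h5 h6, ?_⟩
  have e1 : p₁ ≠ q := by rintro rfl; exact a5 a3
  have e2 : p₁ ≠ r := by rintro rfl; exact a5 a4
  have e3 : p₂ ≠ q := by rintro rfl; exact a6 a3
  have e4 : p₂ ≠ r := by rintro rfl; exact a6 a4
  simp [Finset.card_insert_of_notMem, hp, hq, e1, e2, e3, e4]

section Assignment

variable {n : ℕ} {G : SimpleGraph (Fin n)} {S : Finset (Fin n)}

/-- The capacity that is `1` off `S` and large on `S`. -/
def starCap (S : Finset (Fin n)) (i : Fin n) : ℕ := if i ∈ S then n + 1 else 1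

/-- The degree vector of the matching that sends every `t ∉ S` to `f t ∈ S`. -/
def starDeg (S : Finset (Fin n)) (f : Fin n → Fin n) (i : Fin n) : ℕ :=
  ∑ t ∈ Sᶜ, ((if t = i then 1 else 0) + (if f t = i then 1 else 0))

lemma starDeg_of_mem {f : Fin n → Fin n} {s : Fin n} (hs : s ∈ S) :
    starDeg S f s = (Sᶜ.filter fun t => f t = s).card := by
  rw [starDeg, Finset.card_filter]
  refine Finset.sum_congr rfl fun t ht => ?_
  have : t ≠ s := by rintro rfl; exact Finset.mem_compl.1 ht hs
  simp [this]

lemma starDeg_of_notMem {f : Fin n → Fin n} (hf : ∀ t ∉ S, f t ∈ S) {i : Fin n} (hi : i ∉ S) :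
    starDeg S f i = 1 := by
  have h0 : ∑ t ∈ Sᶜ, (if f t = i then 1 else 0) = 0 := Finset.sum_eq_zero fun t ht => by
    have : f t ≠ i := by rintro rfl; exact hi (hf t (Finset.mem_compl.1 ht))
    simp [this]
  rw [starDeg, Finset.sum_add_distrib, h0, Finset.sum_ite_eq' Sᶜ i,
    if_pos (Finset.mem_compl.2 hi)]

lemma sum_starDeg (f : Fin n → Fin n) : ∑ i, starDeg S f i = 2 * Sᶜ.card := by
  unfold starDeg
  rw [Finset.sum_comm]
  simp [Finset.sum_add_distrib]
  ring

open Classical in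
lemma sum_mem_le (hS : ∀ i ∈ S, ∀ j ∈ S, ¬ G.Adj i j) {w : Fin n → ℕ} (hb : bdd (starCap S) w)
    (hw : IsDeg G w) {X : Finset (Fin n)} (hX : X ⊆ S) :
    ∑ s ∈ X, w s ≤ (Sᶜ.filter fun t => ∃ s ∈ X, G.Adj t s).card := by
  obtain ⟨m, hs, ha, hd⟩ := hw
  have h1 : ∀ s ∈ X, w s = ∑ t ∈ Sᶜ, m s t := by
    intro s hsX
    rw [← hd s]
    refine (Finset.sum_subset (Finset.subset_univ _) fun t _ ht => ?_).symm
    by_contra h0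
    exact hS s (hX hsX) t (by simpa using ht) (ha _ _ h0)
  rw [Finset.sum_congr rfl h1, Finset.sum_comm, Finset.card_filter]
  refine Finset.sum_le_sum fun t ht => ?_
  split_ifs with hex
  · calc ∑ s ∈ X, m s t ≤ ∑ s, m s t :=
          Finset.sum_le_sum_of_subset (Finset.subset_univ _)
      _ = w t := by rw [← hd t]; exact Finset.sum_congr rfl fun s _ => hs s t
      _ ≤ starCap S t := hb t
      _ = 1 := by simp [starCap, Finset.mem_compl.1 ht]
  · refine (Finset.sum_eq_zero fun s hsX => ?_).le
    by_contra h0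
    exact hex ⟨s, hsX, (ha _ _ h0).symm⟩

lemma starDeg_mem_genW (hS : ∀ i ∈ S, ∀ j ∈ S, ¬ G.Adj i j) {f : Fin n → Fin n}
    (hf : ∀ t ∉ S, f t ∈ S ∧ G.Adj t (f t)) : starDeg S f ∈ genW G (starCap S) := by
  classical
  refine mem_genW_iff.2 ⟨fun i => ?_,
    isDeg_sum _ _ fun t ht => isDeg_edge (hf t (Finset.mem_compl.1 ht)).2, fun w hb hw => ?_⟩
  · by_cases hi : i ∈ S
    · rw [starDeg_of_mem hi, starCap, if_pos hi]
      exact (Finset.card_le_univ _).trans (by simp)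
    · rw [starDeg_of_notMem (fun t ht => (hf t ht).1) hi, starCap, if_neg hi]
  · rw [sum_starDeg, ← Finset.sum_add_sum_compl S, two_mul]
    refine add_le_add ((sum_mem_le hS hb hw subset_rfl).trans (Finset.card_filter_le Sᶜ _)) ?_
    rw [Finset.card_eq_sum_ones]
    refine Finset.sum_le_sum fun t ht => (hb t).trans ?_
    simp [starCap, Finset.mem_compl.1 ht]

lemma exists_maximal_indep {s : Finset (Fin n)} (hs : ∀ i ∈ s, ∀ j ∈ s, ¬ G.Adj i j) :
    ∃ S, s ⊆ S ∧ (∀ i ∈ S, ∀ j ∈ S, ¬ G.Adj i j) ∧ ∀ t ∉ S, ∃ i ∈ S, G.Adj t i := by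
  obtain ⟨S, hsS, hS⟩ := Set.Finite.exists_le_maximal
    (s := {s : Finset (Fin n) | ∀ i ∈ s, ∀ j ∈ s, ¬ G.Adj i j}) (Set.toFinite _) hs
  refine ⟨S, hsS, hS.1, fun t ht => ?_⟩
  by_contra! hcon
  refine ht (hS.2 (y := insert t S) ?_ (Finset.subset_insert _ _) (Finset.mem_insert_self _ _))
  intro i hi j hj
  rcases Finset.mem_insert.1 hi with hi | hi <;> rcases Finset.mem_insert.1 hj with hj | hj
  · exact hi ▸ hj ▸ G.irrefl
  · exact hi ▸ hcon j hj
  · exact hj ▸ fun h => hcon i hi h.symm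
  · exact hS.1 i hi j hj

end Assignment

lemma HasTwoCherries.not_sep {n : ℕ} {G : SimpleGraph (Fin n)} (h : HasTwoCherries G) :
    ¬ SEP G := by
  classical
  obtain ⟨p₁, p₂, q, r, t₁, t₂, hp, hqr, a1, a2, a3, a4, a5, a6, h1, h2, h3, h4, h5, h6⟩ := h
  obtain ⟨S, hsub, hS, hmax⟩ := exists_maximal_indep (indep_of_cherries h1 h2 h3 h4 h5 h6)
  have mp₁ : p₁ ∈ S := hsub (by simp)
  have mp₂ : p₂ ∈ S := hsub (by simp)
  have mq : q ∈ S := hsub (by simp)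
  have mr : r ∈ S := hsub (by simp)
  have mt₁ : t₁ ∉ S := fun ht => hS t₁ ht p₁ mp₁ a1
  have mt₂ : t₂ ∉ S := fun ht => hS t₂ ht q mq a3
  have e3 : p₂ ≠ q := by rintro rfl; exact a6 a3
  have e5 : p₁ ≠ q := by rintro rfl; exact a5 a3
  have e4 : p₁ ≠ r := by rintro rfl; exact a5 a4
  have e6 : p₂ ≠ r := by rintro rfl; exact a6 a4
  have pref : ∀ a ∈ S, ∀ b ∈ S, ∀ d ∈ S, ∀ t, ∃ s, t ∉ S → (s ∈ S ∧ G.Adj t s) ∧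
      (G.Adj t a → s = a) ∧ (¬ G.Adj t a → G.Adj t b → s = b) ∧
      (¬ G.Adj t a → ¬ G.Adj t b → G.Adj t d → s = d) := by
    intro a ma b mb d md t
    by_cases ht : t ∈ S
    · exact ⟨t, fun h => absurd ht h⟩
    by_cases ha : G.Adj t a
    · exact ⟨a, by grind⟩
    by_cases hb : G.Adj t b
    · exact ⟨b, by grind⟩
    by_cases hd : G.Adj t d
    · exact ⟨d, by grind⟩
    obtain ⟨s, hs, hts⟩ := hmax t ht
    exact ⟨s, by grind⟩
  choose f hf using pref p₁ mp₁ p₂ mp₂ q mq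
  choose g hg using pref p₂ mp₂ p₁ mp₁ r mr
  have hu := starDeg_mem_genW hS fun t ht => (hf t ht).1
  have hv := starDeg_mem_genW hS fun t ht => (hg t ht).1
  have hξ : starDeg S g q < starDeg S f q := by
    rw [starDeg_of_mem mq, starDeg_of_mem mq]
    refine Finset.card_lt_card (Finset.ssubset_iff_of_subset ?_ |>.2 ⟨t₂, ?_, ?_⟩)
    · intro t
      simp only [Finset.mem_filter, Finset.mem_compl]
      rintro ⟨ht, hgt⟩
      have := hf t ht
      have := hg t ht
      grind
    · have := hf t₂ mt₂
      simp only [Finset.mem_filter, Finset.mem_compl]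
      grind
    · have := hg t₂ mt₂
      simp only [Finset.mem_filter, Finset.mem_compl]
      grind
  have hρ : starDeg S f p₂ < starDeg S g p₂ := by
    rw [starDeg_of_mem mp₂, starDeg_of_mem mp₂]
    refine Finset.card_lt_card (Finset.ssubset_iff_of_subset ?_ |>.2 ⟨t₁, ?_, ?_⟩)
    · intro t
      simp only [Finset.mem_filter, Finset.mem_compl]
      rintro ⟨ht, hgt⟩
      have := hf t ht
      have := hg t ht
      grind
    · have := hg t₁ mt₁
      simp only [Finset.mem_filter, Finset.mem_compl]
      grind
    · have := hf t₁ mt₁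
      simp only [Finset.mem_filter, Finset.mem_compl]
      grind
  intro hsep
  have hw := hsep (starCap S) (fun i => by unfold starCap; split_ifs <;> omega) _ hu _ hv q p₂ hξ hρ
  obtain ⟨hb, hd, -⟩ := mem_genW_iff.1 hw
  have hle := sum_mem_le hS hb hd (X := {p₁, p₂}) (by
    intro i hi
    rcases Finset.mem_insert.1 hi with rfl | hi
    · exact mp₁
    · rwa [Finset.mem_singleton.1 hi])
  rw [Finset.sum_pair hp, exch_apply_self, exch_apply_of_ne _ e5 hp, starDeg_of_mem mp₁,
    starDeg_of_mem mp₂, ← add_assoc, ← Finset.card_union_of_disjoint] at hle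
  · refine absurd hle (not_le.2 (Nat.lt_succ_of_le (Finset.card_le_card ?_)))
    intro t
    simp only [Finset.mem_filter, Finset.mem_compl, Finset.mem_union, Finset.mem_insert,
      Finset.mem_singleton]
    rintro ⟨ht, s, hs, hts⟩
    have := hf t ht
    grind
  · rw [Finset.disjoint_filter]
    grind

/-- The edges of the cycle `0, 1, …, m - 1`. -/
def cycleEdges (m : ℕ) : List (ℕ × ℕ) := (0, m - 1) :: (List.range (m - 1)).map fun i => (i, i + 1)

instance {m : ℕ} {E : List (ℕ × ℕ)} : DecidableRel (listGraph m E).Adj := fun i j =>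
  inferInstanceAs (Decidable (i ≠ j ∧ ((i.val, j.val) ∈ E ∨ (j.val, i.val) ∈ E)))

/-- The edges of the first `ℓ` vertices of a graph, as a 0-1 matrix. -/
def adjBelow {k : ℕ} (G : SimpleGraph (Fin k)) [DecidableRel G.Adj] (ℓ : ℕ) (i j : Fin k) : ℕ :=
  if G.Adj i j ∧ i.val < ℓ ∧ j.val < ℓ then 1 else 0

/-- The matching of the cycle `0, 1, …, ℓ - 1` missing only the vertex `z`, for odd `ℓ`. -/
def nearMatching {k : ℕ} (ℓ : ℕ) (z i j : Fin k) : ℕ :=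
  if i.val < ℓ ∧ j.val < ℓ ∧ (((i.val + 1) % ℓ = j.val ∧ (i.val + ℓ - z.val) % ℓ % 2 = 1) ∨
    ((j.val + 1) % ℓ = i.val ∧ (j.val + ℓ - z.val) % ℓ % 2 = 1)) then 1 else 0

lemma exists_isDeg_of_parity {k ℓ : ℕ} {G : SimpleGraph (Fin k)} [DecidableRel G.Adj]
    {g : Fin k → ℕ} {m : Fin k → Fin k → ℕ} (hs : ∀ i j, m i j = m j i)
    (ha : ∀ i j, m i j ≠ 0 → G.Adj i j) (hd : ∀ i, ∑ j, m i j = 2 * g i)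
    (hp : ∀ i j, m i j % 2 = adjBelow G ℓ i j) {z : Fin k}
    (hN : (∀ i j, nearMatching ℓ z i j = nearMatching ℓ z j i) ∧
      (∀ i j, nearMatching ℓ z i j ≠ 0 → G.Adj i j) ∧
      ∀ i, ∑ j, adjBelow G ℓ i j = 2 * ((∑ j, nearMatching ℓ z i j) + if z = i then 1 else 0)) :
    ∃ w, IsDeg G w ∧ ∀ i, w i + (if z = i then 1 else 0) = g i := by
  obtain ⟨hNs, hNa, hNd⟩ := hN
  refine ⟨fun i => ∑ j, (m i j / 2 + nearMatching ℓ z i j),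
    ⟨fun i j => m i j / 2 + nearMatching ℓ z i j, fun i j => by simp only [hs i j, hNs i j],
      fun i j h => ?_, fun i => rfl⟩, fun i => ?_⟩
  · by_cases h0 : m i j = 0
    · exact hNa i j (by simp only [h0] at h; omega)
    · exact ha i j h0
  · have h1 : ∑ j, m i j = 2 * ∑ j, m i j / 2 + ∑ j, adjBelow G ℓ i j := by
      rw [Finset.mul_sum, ← Finset.sum_add_distrib]
      refine Finset.sum_congr rfl fun j _ => ?_
      rw [← hp i j, Nat.div_add_mod]
    have h2 := hd i
    have h3 := hNd i
    simp only [Finset.sum_add_distrib]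
    omega

lemma sum_eq_sum_adj {k : ℕ} {G : SimpleGraph (Fin k)} [DecidableRel G.Adj]
    {m : Fin k → Fin k → ℕ} (hs : ∀ i j, m i j = m j i)
    (ha : ∀ i j, m i j ≠ 0 → G.Adj i j) (i : Fin k) :
    ∑ j, m i j = ∑ j, if G.Adj i j then (if i < j then m i j else m j i) else 0 := by
  refine Finset.sum_congr rfl fun j _ => ?_
  split_ifs with h h'
  · rfl
  · exact hs i j
  · by_contra h'
    exact h (ha i j h')

lemma adjBelow_of_lt {k ℓ : ℕ} {G : SimpleGraph (Fin k)} [DecidableRel G.Adj]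
    {m : Fin k → Fin k → ℕ} (hs : ∀ i j, m i j = m j i)
    (ha : ∀ i j, m i j ≠ 0 → G.Adj i j)
    (hp : ∀ i j, i < j → G.Adj i j → m i j % 2 = adjBelow G ℓ i j) (i j : Fin k) :
    m i j % 2 = adjBelow G ℓ i j := by
  by_cases h : G.Adj i j
  · rcases lt_or_gt_of_ne h.ne with h' | h'
    · exact hp i j h' h
    · rw [hs, hp j i h' h.symm]
      simp only [adjBelow, G.adj_comm, and_comm]
  · have h0 : m i j = 0 := by
      by_contra h0
      exact h (ha i j h0)
    simp [adjBelow, h, h0]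

lemma good_cycle_five : Good (listGraph 5 (cycleEdges 5)) {i | i.val < 5} where
  indep := by decide
  odd := by
    rintro g ⟨q, hq⟩ ⟨m, hs, ha, hd⟩ z hz
    refine exists_isDeg_of_parity (ℓ := 5) hs ha hd (adjBelow_of_lt hs ha ?_) ?_
    · have h2 : ∀ i, _ := fun i => (sum_eq_sum_adj hs ha i).symm.trans (hd i)
      simp +decide [Fin.forall_fin_succ, Fin.sum_univ_five] at h2 hq
      intro i j
      fin_cases i <;> fin_cases j <;> simp +decide [adjBelow] <;> omega
    · revert z
      decide
  far := by decide

set_option maxRecDepth 10000 in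
lemma good_cycle_seven : Good (listGraph 7 (cycleEdges 7)) {i | i.val < 7} where
  indep := by decide
  odd := by
    rintro g ⟨q, hq⟩ ⟨m, hs, ha, hd⟩ z hz
    refine exists_isDeg_of_parity (ℓ := 7) hs ha hd (adjBelow_of_lt hs ha ?_) ?_
    · have h2 : ∀ i, _ := fun i => (sum_eq_sum_adj hs ha i).symm.trans (hd i)
      simp +decide [Fin.forall_fin_succ, Fin.sum_univ_seven] at h2 hq
      intro i j
      fin_cases i <;> fin_cases j <;> simp +decide [adjBelow] <;> omega
    · revert z
      decide
  far := by decide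

lemma good_cycle_five_pendant : Good (listGraph 6 ((0, 5) :: cycleEdges 5)) {i | i.val < 5} where
  indep := by decide
  odd := by
    rintro g ⟨q, hq⟩ ⟨m, hs, ha, hd⟩ z hz
    refine exists_isDeg_of_parity (ℓ := 5) hs ha hd (adjBelow_of_lt hs ha ?_) ?_
    · have h2 : ∀ i, _ := fun i => (sum_eq_sum_adj hs ha i).symm.trans (hd i)
      simp +decide [Fin.forall_fin_succ, Fin.sum_univ_six] at h2 hq
      intro i j
      fin_cases i <;> fin_cases j <;> simp +decide [adjBelow] <;> omega
    · revert z
      decide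
  far := by decide

set_option maxRecDepth 10000 in
lemma good_cycle_five_tail : Good (listGraph 7 ((5, 6) :: (0, 5) :: cycleEdges 5)) {i | i.val < 5} where
  indep := by decide
  odd := by
    rintro g ⟨q, hq⟩ ⟨m, hs, ha, hd⟩ z hz
    refine exists_isDeg_of_parity (ℓ := 5) hs ha hd (adjBelow_of_lt hs ha ?_) ?_
    · have h2 : ∀ i, _ := fun i => (sum_eq_sum_adj hs ha i).symm.trans (hd i)
      simp +decide [Fin.forall_fin_succ, Fin.sum_univ_seven] at h2 hq
      intro i j
      fin_cases i <;> fin_cases j <;> simp +decide [adjBelow] <;> omega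
    · revert z
      decide
  far := by decide

lemma good_cycle_six : Good (listGraph 6 (cycleEdges 6)) {i | i.val < 6} where
  indep := by decide
  odd := by
    rintro g ⟨q, hq⟩ ⟨m, hs, ha, hd⟩ z hz
    have h2 : ∀ i, _ := fun i => (sum_eq_sum_adj hs ha i).symm.trans (hd i)
    simp +decide [Fin.forall_fin_succ, Fin.sum_univ_six] at h2 hq
    omega
  far := by decide

lemma IsDeg.comp_iso {k n : ℕ} {H : SimpleGraph (Fin k)} {G : SimpleGraph (Fin n)} (φ : H ≃g G)
    {w : Fin n → ℕ} (h : IsDeg G w) : IsDeg H (fun i => w (φ i)) := by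
  obtain ⟨m, hs, ha, hd⟩ := h
  refine ⟨fun i j => m (φ i) (φ j), fun i j => hs _ _, fun i j h => φ.map_adj_iff.1 (ha _ _ h),
    fun i => ?_⟩
  refine Eq.trans ?_ (hd (φ i))
  exact Equiv.sum_comp φ.toEquiv fun j => m (φ i) j

lemma Good.of_iso {k n : ℕ} {H : SimpleGraph (Fin k)} {G : SimpleGraph (Fin n)} {C : Set (Fin k)}
    (h : Good H C) (φ : H ≃g G) : Good G {x | φ.symm x ∈ C} where
  indep s hs := by
    have := h.indep (s.map φ.symm.toEquiv.toEmbedding) (by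
      simp only [Finset.mem_map]
      rintro _ ⟨i, hi, rfl⟩ _ ⟨j, hj, rfl⟩ hij
      exact hs i hi j hj (φ.symm.map_adj_iff.1 hij))
    rwa [Finset.card_map] at this
  odd g hg hd z hz := by
    obtain ⟨w, hw, h'⟩ := h.odd (fun i => g (φ i))
      (by rwa [show ∑ i, g (φ i) = ∑ i, g i from Equiv.sum_comp φ.toEquiv g])
      (hd.comp_iso φ) (φ.symm z) hz
    refine ⟨fun x => w (φ.symm x), hw.comp_iso φ.symm, fun x => ?_⟩
    have := h' (φ.symm x)
    rw [φ.apply_symm_apply] at this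
    simpa only [EmbeddingLike.apply_eq_iff_eq] using this
  far a b hab := by
    have key : ∀ a, (∃ z ∈ C, H.Adj z (φ.symm a)) → ∃ z ∈ {x | φ.symm x ∈ C}, G.Adj z a := by
      rintro a ⟨z, hz, hza⟩
      refine ⟨φ z, by simpa using hz, ?_⟩
      have := φ.map_adj_iff.2 hza
      rwa [φ.apply_symm_apply] at this
    exact (h.far (φ.symm a) (φ.symm b) (by simpa using hab)).imp (key a) (key b)

lemma HasTwoCherries.map {k n : ℕ} {H : SimpleGraph (Fin k)} {G : SimpleGraph (Fin n)}
    (h : HasTwoCherries H) (φ : H ↪g G) : HasTwoCherries G := by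
  obtain ⟨p₁, p₂, q, r, t₁, t₂, h⟩ := h
  refine ⟨φ p₁, φ p₂, φ q, φ r, φ t₁, φ t₂, ?_⟩
  simpa only [φ.map_adj_iff, ne_eq, φ.injective.eq_iff] using h

lemma exists_adj_boundary {n : ℕ} {G : SimpleGraph (Fin n)} (hconn : G.Connected)
    {U : Set (Fin n)} {u v : Fin n} (hu : u ∈ U) (hv : v ∉ U) : ∃ x ∈ U, ∃ y ∉ U, G.Adj x y := by
  obtain ⟨p⟩ := hconn.preconnected u v
  obtain ⟨d, -, h1, h2⟩ := p.exists_boundary_dart U hu hv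
  exact ⟨d.fst, h1, d.snd, h2, d.adj⟩

open Classical in
/-- Every nonempty set of vertices of a unicyclic graph spans at most as many edges as it has
vertices. -/
lemma card_adj_pairs_le {n : ℕ} {G : SimpleGraph (Fin n)} (hconn : G.Connected)
    (hedge : G.edgeSet.ncard = n) (U : Finset (Fin n)) (hU : U.Nonempty) :
    (∑ i ∈ U, ∑ j ∈ U, if G.Adj i j then 1 else 0) ≤ 2 * U.card := by
  induction h : n - U.card generalizing U with
  | zero =>
    have hle : U.card ≤ n := by simpa using Finset.card_le_univ U
    have hUn : U = Finset.univ := by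
      rw [← Finset.card_eq_iff_eq_univ, Fintype.card_fin]; omega
    subst hUn
    have h1 := G.sum_degrees_eq_twice_card_edges
    have h2 : G.edgeFinset.card = n := by
      rwa [← SimpleGraph.coe_edgeFinset, Set.ncard_coe_finset] at hedge
    rw [h2] at h1
    rw [Finset.card_univ, Fintype.card_fin, ← h1]
    refine Finset.sum_le_sum fun i _ => ?_
    rw [← Finset.sum_filter, Finset.sum_const, smul_eq_mul, mul_one,
      ← SimpleGraph.card_neighborFinset_eq_degree, SimpleGraph.neighborFinset_eq_filter]
  | succ k ih =>
    obtain ⟨u, hu⟩ := hU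
    obtain ⟨v, hv⟩ : ∃ v, v ∉ U := by
      by_contra! hc
      rw [Finset.eq_univ_of_forall hc, Finset.card_univ, Fintype.card_fin] at h
      omega
    obtain ⟨x, hx, y, hy, hxy⟩ := exists_adj_boundary hconn (U := (U : Set (Fin n)))
      (Finset.mem_coe.2 hu) (fun h => hv (Finset.mem_coe.1 h))
    replace hx := Finset.mem_coe.1 hx
    replace hy : y ∉ U := fun h => hy (Finset.mem_coe.2 h)
    have h1 := ih (insert y U) (Finset.insert_nonempty _ _)
      (by rw [Finset.card_insert_of_notMem hy]; omega)
    rw [Finset.card_insert_of_notMem hy] at h1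
    simp only [Finset.sum_insert hy, Finset.sum_add_distrib, SimpleGraph.irrefl, if_false] at h1
    have h2 : 1 ≤ ∑ j ∈ U, if G.Adj y j then 1 else 0 := by
      refine le_trans ?_ (Finset.single_le_sum (fun _ _ => Nat.zero_le _) hx)
      simp [hxy.symm]
    have h3 : 1 ≤ ∑ j ∈ U, if G.Adj j y then 1 else 0 := by
      refine le_trans ?_ (Finset.single_le_sum (fun _ _ => Nat.zero_le _) hx)
      simp [hxy]
    omega

/-- `E` lists as many distinct edges as there are vertices, on the vertices `0, 1, …, k - 1`. -/
abbrev IsEdgeList (k : ℕ) (E : List (ℕ × ℕ)) : Prop :=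
  E.Nodup ∧ (∀ e ∈ E, e.1 < e.2 ∧ e.2 < k) ∧ E.length = k ∧ 0 < k

/-- `f` embeds the graph on `0, 1, …, k - 1` with edges `E` into `G`, as a subgraph. -/
structure Pattern {n : ℕ} (G : SimpleGraph (Fin n)) (k : ℕ) (E : List (ℕ × ℕ)) (f : ℕ → Fin n) :
    Prop where
  inj : ∀ i < k, ∀ j < k, f i = f j → i = j
  adj : ∀ e ∈ E, G.Adj (f e.1) (f e.2)

open Classical in
lemma Pattern.adj_iff {n k : ℕ} {G : SimpleGraph (Fin n)} {E : List (ℕ × ℕ)} {f : ℕ → Fin n}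
    (h : Pattern G k E f) (hconn : G.Connected) (hedge : G.edgeSet.ncard = n)
    (hE : IsEdgeList k E) {i j : ℕ} (hi : i < k) (hj : j < k) :
    G.Adj (f i) (f j) ↔ (i, j) ∈ E ∨ (j, i) ∈ E := by
  obtain ⟨hnd, hlt, hlen, hk⟩ := hE
  refine ⟨fun hij => ?_, fun hij => hij.elim (h.adj _) fun h' => (h.adj _ h').symm⟩
  let S : Finset (ℕ × ℕ) := (range k ×ˢ range k).filter fun p => G.Adj (f p.1) (f p.2)
  let T : Finset (ℕ × ℕ) := E.toFinset ∪ E.toFinset.map (Equiv.prodComm ℕ ℕ).toEmbedding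
  have hTS : T ⊆ S := by
    intro p hp
    simp only [T, S, Finset.mem_union, List.mem_toFinset, Finset.mem_map, Finset.mem_filter,
      Finset.mem_product, Finset.mem_range] at hp ⊢
    rcases hp with hp | ⟨p, hp, rfl⟩
    · have := hlt p hp
      exact ⟨⟨by omega, by omega⟩, h.adj p hp⟩
    · have := hlt p hp
      exact ⟨⟨this.2, this.1.trans this.2⟩, (h.adj p hp).symm⟩
  have hT : T.card = 2 * k := by
    rw [Finset.card_union_of_disjoint, Finset.card_map, List.toFinset_card_of_nodup hnd, hlen,
      two_mul]
    rw [Finset.disjoint_left]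
    intro p hp hp'
    simp only [List.mem_toFinset, Finset.mem_map] at hp hp'
    obtain ⟨p', hp', rfl⟩ := hp'
    have h1 := (hlt p' hp').1
    have h2 := (hlt _ hp).1
    simp at h2
    omega
  have hinj : Set.InjOn f (range k : Set ℕ) := fun a ha b hb =>
    h.inj a (by simpa using ha) b (by simpa using hb)
  have hS : S.card ≤ 2 * k := by
    have h1 := card_adj_pairs_le hconn hedge ((range k).image f)
      ((Finset.nonempty_range_iff.2 hk.ne').image f)
    rw [Finset.card_image_of_injOn hinj, Finset.card_range, Finset.sum_image hinj] at h1
    simp only [Finset.sum_image hinj] at h1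
    rwa [← Finset.sum_product', ← Finset.card_filter] at h1
  have hEq : T = S := Finset.eq_of_subset_of_card_le hTS (by omega)
  have hmem : (i, j) ∈ T := by
    rw [hEq]
    simp only [S, Finset.mem_filter, Finset.mem_product, Finset.mem_range]
    exact ⟨⟨hi, hj⟩, hij⟩
  simp only [T, Finset.mem_union, List.mem_toFinset, Finset.mem_map] at hmem
  refine hmem.imp id ?_
  rintro ⟨⟨a, b⟩, hp, hp'⟩
  cases hp'
  exact hp

lemma Pattern.exists_embedding {n k : ℕ} {G : SimpleGraph (Fin n)} {E : List (ℕ × ℕ)}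
    {f : ℕ → Fin n} (h : Pattern G k E f) (hconn : G.Connected) (hedge : G.edgeSet.ncard = n)
    (hE : IsEdgeList k E) : ∃ φ : listGraph k E ↪g G, ∀ i, φ i = f i := by
  refine ⟨⟨⟨fun i => f i, fun i j hij => Fin.ext (h.inj _ i.isLt _ j.isLt hij)⟩, ?_⟩, fun i => rfl⟩
  intro i j
  change G.Adj (f i) (f j) ↔ i ≠ j ∧ ((i.val, j.val) ∈ E ∨ (j.val, i.val) ∈ E)
  rw [h.adj_iff hconn hedge hE i.isLt j.isLt, iff_and_self]
  rintro hij rfl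
  exact lt_irrefl _ (hE.2.1 _ (or_self_iff.1 hij)).1

lemma Pattern.hasTwoCherries {n k : ℕ} {G : SimpleGraph (Fin n)} {E : List (ℕ × ℕ)}
    {f : ℕ → Fin n} (h : Pattern G k E f) (hconn : G.Connected) (hedge : G.edgeSet.ncard = n)
    (hE : IsEdgeList k E) (hc : HasTwoCherries (listGraph k E)) : HasTwoCherries G := by
  obtain ⟨φ, -⟩ := h.exists_embedding hconn hedge hE
  exact hc.map φ

/-- A pattern carried by a good graph either covers `G` or has a further vertex attached to it. -/
lemma Pattern.good_or_exists_adj {n k : ℕ} {G : SimpleGraph (Fin n)} {E : List (ℕ × ℕ)}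
    {f : ℕ → Fin n} (h : Pattern G k E f) (hconn : G.Connected) (hedge : G.edgeSet.ncard = n)
    (hE : IsEdgeList k E) {C : Set (Fin k)} (hg : Good (listGraph k E) C) :
    (∃ C', Good G C') ∨ ∃ i < k, ∃ a, (∀ j < k, f j ≠ a) ∧ G.Adj (f i) a := by
  by_cases hs : ∃ v, ∀ j < k, f j ≠ v
  · right
    obtain ⟨v, hv⟩ := hs
    obtain ⟨x, ⟨i, hi, rfl⟩, y, hy, hxy⟩ := exists_adj_boundary hconn
      (U := {x | ∃ j < k, f j = x}) (v := v) ⟨0, hE.2.2.2, rfl⟩ (fun ⟨j, hj, h⟩ => hv j hj h)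
    exact ⟨i, hi, y, fun j hj h => hy ⟨j, hj, h⟩, hxy⟩
  · left
    push Not at hs
    obtain ⟨φ, hφ⟩ := h.exists_embedding hconn hedge hE
    refine ⟨_, hg.of_iso (RelIso.ofSurjective φ fun x => ?_)⟩
    obtain ⟨j, hj, rfl⟩ := hs x
    exact ⟨⟨j, hj⟩, hφ _⟩

lemma Pattern.extend {n k : ℕ} {G : SimpleGraph (Fin n)} {E : List (ℕ × ℕ)}
    {f : ℕ → Fin n} (h : Pattern G k E f) (hE : IsEdgeList k E) {i : ℕ} (hi : i < k) {a : Fin n}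
    (ha : ∀ j < k, f j ≠ a) (hia : G.Adj (f i) a) :
    Pattern G (k + 1) ((i, k) :: E) (Function.update f k a) := by
  have hu : ∀ j < k, Function.update f k a j = f j := fun j hj =>
    Function.update_of_ne hj.ne _ _
  constructor
  · intro j hj j' hj' he
    rcases Nat.lt_succ_iff_lt_or_eq.1 hj with hj | rfl <;>
      rcases Nat.lt_succ_iff_lt_or_eq.1 hj' with hj' | rfl
    · rw [hu j hj, hu j' hj'] at he
      exact h.inj _ hj _ hj' he
    · rw [hu j hj, Function.update_self] at he
      exact absurd he (ha j hj)
    · rw [hu j' hj', Function.update_self] at he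
      exact absurd he.symm (ha j' hj')
    · rfl
  · intro e he
    rcases List.mem_cons.1 he with rfl | he
    · simpa [hu i hi] using hia
    · have := hE.2.1 e he
      rw [hu _ this.2, hu _ (this.1.trans this.2)]
      exact h.adj e he

/-- `f` is a closed walk of length `ℓ` with distinct vertices. -/
structure CyclePattern {n : ℕ} (G : SimpleGraph (Fin n)) (ℓ : ℕ) (f : ℕ → Fin n) : Prop where
  inj : ∀ i < ℓ, ∀ j < ℓ, f i = f j → i = j
  adj : ∀ i < ℓ, G.Adj (f i) (f ((i + 1) % ℓ))

lemma CyclePattern.rotate {n ℓ : ℕ} {G : SimpleGraph (Fin n)} {f : ℕ → Fin n}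
    (h : CyclePattern G ℓ f) (r : ℕ) : CyclePattern G ℓ fun i => f ((i + r) % ℓ) where
  inj i hi j hj hij := by
    have h0 : 0 < ℓ := by omega
    have h1 : i % ℓ = j % ℓ := Nat.ModEq.add_right_cancel' r
      (h.inj _ (Nat.mod_lt _ h0) _ (Nat.mod_lt _ h0) hij)
    rwa [Nat.mod_eq_of_lt hi, Nat.mod_eq_of_lt hj] at h1
  adj i hi := by
    have h0 : 0 < ℓ := by omega
    have := h.adj ((i + r) % ℓ) (Nat.mod_lt _ h0)
    rw [Nat.mod_add_mod] at this
    rwa [Nat.mod_add_mod, add_right_comm]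

lemma CyclePattern.pattern {n ℓ : ℕ} {G : SimpleGraph (Fin n)} {f : ℕ → Fin n}
    (h : CyclePattern G ℓ f) (hl : 0 < ℓ) : Pattern G ℓ (cycleEdges ℓ) f where
  inj := h.inj
  adj e he := by
    simp only [cycleEdges, List.mem_cons, List.mem_map, List.mem_range] at he
    rcases he with rfl | ⟨i, hi, rfl⟩
    · have := h.adj (ℓ - 1) (by omega)
      rw [Nat.sub_add_cancel hl, Nat.mod_self] at this
      exact this.symm
    · have := h.adj i (by omega)
      rwa [Nat.mod_eq_of_lt (by omega)] at this

lemma exists_cyclePattern {n ℓ : ℕ} {G : SimpleGraph (Fin n)} (hl : 0 < ℓ) (hg : G.girth = ℓ) :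
    ∃ f, CyclePattern G ℓ f := by
  have hna : ¬ G.IsAcyclic := fun h => by
    rw [SimpleGraph.girth_eq_zero.2 h] at hg
    omega
  obtain ⟨a, c, hc, hlen⟩ := SimpleGraph.exists_girth_eq_length.2 hna
  rw [hg] at hlen
  refine ⟨c.getVert, fun i hi j hj hij => hc.getVert_injOn' (by simp; omega) (by simp; omega) hij,
    fun i hi => ?_⟩
  have := c.adj_getVert_succ (i := i) (by omega)
  rcases Nat.lt_or_ge (i + 1) ℓ with h | h
  · rwa [Nat.mod_eq_of_lt h]
  · have h' : i + 1 = ℓ := by omega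
    rw [h', Nat.mod_self, SimpleGraph.Walk.getVert_zero]
    rwa [h', hlen, SimpleGraph.Walk.getVert_length] at this

/-- A cycle of `G` carrying a good graph either is all of `G` or has a pendant edge attached to
it, which may be assumed to sit at its first vertex. -/
lemma good_or_exists_pendant {n ℓ : ℕ} {G : SimpleGraph (Fin n)} (hconn : G.Connected)
    (hedge : G.edgeSet.ncard = n) (hg : G.girth = ℓ) (hE : IsEdgeList ℓ (cycleEdges ℓ))
    {C : Set (Fin ℓ)} (hC : Good (listGraph ℓ (cycleEdges ℓ)) C) :
    (∃ C', Good G C') ∨ ∃ f, Pattern G (ℓ + 1) ((0, ℓ) :: cycleEdges ℓ) f := by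
  have h0 : 0 < ℓ := hE.2.2.2
  obtain ⟨f, hf⟩ := exists_cyclePattern h0 hg
  refine ((hf.pattern h0).good_or_exists_adj hconn hedge hE hC).imp id ?_
  rintro ⟨i, hi, a, ha, hia⟩
  exact ⟨_, ((hf.rotate i).pattern h0).extend hE h0 (fun j _ => ha _ (Nat.mod_lt _ h0))
    (by simpa [Nat.mod_eq_of_lt hi] using hia)⟩

lemma hasTwoCherries_of_tail {n i : ℕ} {G : SimpleGraph (Fin n)} {f : ℕ → Fin n}
    (hconn : G.Connected) (hedge : G.edgeSet.ncard = n) (hi : i < 7)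
    (h : Pattern G 8 ((i, 7) :: (5, 6) :: (0, 5) :: cycleEdges 5) f) : HasTwoCherries G := by
  interval_cases i <;> refine h.hasTwoCherries hconn hedge (by decide) ?_
  · exact ⟨5, 7, 1, 3, 0, 2, by decide⟩
  · exact ⟨5, 4, 7, 2, 0, 1, by decide⟩
  · exact ⟨7, 3, 5, 1, 2, 0, by decide⟩
  · exact ⟨7, 2, 5, 4, 3, 0, by decide⟩
  · exact ⟨5, 1, 7, 3, 0, 4, by decide⟩
  · exact ⟨6, 7, 1, 3, 5, 2, by decide⟩
  · exact ⟨5, 7, 1, 3, 6, 2, by decide⟩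

lemma hasTwoCherries_or_good_five {n : ℕ} {G : SimpleGraph (Fin n)} (hconn : G.Connected)
    (hedge : G.edgeSet.ncard = n) (hg : G.girth = 5) : HasTwoCherries G ∨ ∃ C, Good G C := by
  rcases good_or_exists_pendant hconn hedge hg (by decide) good_cycle_five with h | ⟨f, hf⟩
  · exact Or.inr h
  rcases hf.good_or_exists_adj hconn hedge (by decide) good_cycle_five_pendant with
    h | ⟨i, hi, a, ha, hia⟩
  · exact Or.inr h
  have hf' := hf.extend (by decide) hi ha hia
  by_cases h5 : i = 5
  · subst h5
    rcases hf'.good_or_exists_adj hconn hedge (by decide) good_cycle_five_tail with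
      h | ⟨j, hj, b, hb, hjb⟩
    · exact Or.inr h
    · exact Or.inl (hasTwoCherries_of_tail hconn hedge hj (hf'.extend (by decide) hj hb hjb))
  · left
    have hi5 : i < 5 := by omega
    interval_cases i <;> refine hf'.hasTwoCherries hconn hedge (by decide) ?_
    · exact ⟨5, 6, 1, 3, 0, 2, by decide⟩
    · exact ⟨5, 4, 6, 2, 0, 1, by decide⟩
    · exact ⟨6, 3, 5, 1, 2, 0, by decide⟩
    · exact ⟨6, 2, 5, 4, 3, 0, by decide⟩
    · exact ⟨5, 1, 6, 3, 0, 4, by decide⟩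

lemma hasTwoCherries_or_good {n ℓ : ℕ} {G : SimpleGraph (Fin n)} (hconn : G.Connected)
    (hedge : G.edgeSet.ncard = n) (hl : ℓ = 5 ∨ ℓ = 6 ∨ ℓ = 7) (hg : G.girth = ℓ) :
    HasTwoCherries G ∨ ∃ C, Good G C := by
  rcases hl with rfl | rfl | rfl
  · exact hasTwoCherries_or_good_five hconn hedge hg
  · refine (good_or_exists_pendant hconn hedge hg (by decide) good_cycle_six).symm.imp ?_ id
    rintro ⟨f, hf⟩
    exact hf.hasTwoCherries hconn hedge (by decide) ⟨6, 1, 3, 5, 0, 4, by decide⟩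
  · refine (good_or_exists_pendant hconn hedge hg (by decide) good_cycle_seven).symm.imp ?_ id
    rintro ⟨f, hf⟩
    exact hf.hasTwoCherries hconn hedge (by decide) ⟨7, 1, 3, 5, 0, 4, by decide⟩

/-- A unicyclic graph (connected, with as many edges as vertices) whose
unique cycle has length `ℓ ∈ {5,6,7}` (the girth) enjoys the strong exchange property
iff its independence number is at most three. -/
theorem stmt19 (n ℓ : ℕ) (G : SimpleGraph (Fin n)) (hconn : G.Connected)
    (hedge : G.edgeSet.ncard = n) (hl : ℓ = 5 ∨ ℓ = 6 ∨ ℓ = 7)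
    (hgirth : G.girth = (ℓ : ℕ∞)) :
    SEP G ↔
      ∀ s : Finset (Fin n), (∀ i ∈ s, ∀ j ∈ s, ¬ G.Adj i j) → s.card ≤ 3 := by
  rcases hasTwoCherries_or_good hconn hedge hl (by exact_mod_cast hgirth) with h | ⟨C, h⟩
  · refine iff_of_false h.not_sep fun hle => ?_
    obtain ⟨s, hs, h4⟩ := h.exists_indep
    have := hle s hs
    omega
  · exact iff_of_true h.sep h.indep
end
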